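/- arXiv:math-ph/0004001 — 10 statements merged into one kernel-verified Lean document; each statement's English description precedes it below -/
import Mathlib

section
/- Let A < a < b < B be real numbers, and let f be a Herglotzian function holomorphic in Ω(A, B). Then for each z ∈ (a, b), f(z) ≥ [(B−b)(z−a)f(b) + (B−a)(b−z)f(a)] / [(b−a)(B−z)]. -/
open Complex Set

noncomputable section

/-- The open upper half-plane. -/
def UpperHalf : Set ℂ := {z | 0 < z.im}

/-- The open lower half-plane. -/
def LowerHalf : Set ℂ := {z | z.im < 0}

/-- `Omega s t = C₊ ∪ C₋ ∪ (s,t)`. -/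
def Omega (s t : ℝ) : Set ℂ := UpperHalf ∪ LowerHalf ∪ (Complex.ofReal '' Set.Ioo s t)

/-- A Herglotz (Pick) function on `Omega s t`. -/
def Herglotzian (s t : ℝ) (f : ℂ → ℂ) : Prop :=
  DifferentiableOn ℂ f (Omega s t) ∧
  (∀ z ∈ Omega s t, f (starRingEnd ℂ z) = starRingEnd ℂ (f z)) ∧
  (∀ z ∈ Omega s t, 0 < z.im → 0 ≤ (f z).im)

/-- An anti-Herglotz function on `Omega s t`. -/
def AntiHerglotzian (s t : ℝ) (f : ℂ → ℂ) : Prop :=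
  DifferentiableOn ℂ f (Omega s t) ∧
  (∀ z ∈ Omega s t, f (starRingEnd ℂ z) = starRingEnd ℂ (f z)) ∧
  (∀ z ∈ Omega s t, 0 < z.im → (f z).im ≤ 0)


open Filter Topology

theorem Complex.im_unit_circle_kernel_mul (u : ℂ) (hu : ‖u‖ = 1) (w : ℂ) :
    (I * u * (u ^ 3)⁻¹ * (w * (-1 + 2 * u - 2 * u ^ 3 + u ^ 4))).im =
      4 * (1 - u.re) * (u.im * w.im) := by
  have hu0 : u ≠ 0 := by
    rintro rfl
    simp at hu
  have hn : u.re * u.re + u.im * u.im = 1 := by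
    rw [← normSq_apply, normSq_eq_norm_sq, hu, one_pow]
  have hinv : u⁻¹ = starRingEnd ℂ u := by
    rw [inv_def, normSq_eq_norm_sq, hu]
    simp
  have h : I * u * (u ^ 3)⁻¹ * (w * (-1 + 2 * u - 2 * u ^ 3 + u ^ 4)) =
      I * w * (-u⁻¹ ^ 2 + 2 * u⁻¹ - 2 * u + u ^ 2) := by
    field_simp
  have h2 : -u⁻¹ ^ 2 + 2 * u⁻¹ - 2 * u + u ^ 2 = ((-4 * (1 - u.re) * u.im : ℝ) : ℂ) * I := by
    rw [hinv]
    apply Complex.ext <;> simp [pow_two]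
    ring
  rw [h, h2]
  simp
  ring

theorem iteratedDeriv_two_eq_of_hasDerivAt {G G' : ℂ → ℂ} {z c : ℂ}
    (h : ∀ᶠ w in 𝓝 z, HasDerivAt G (G' w) w) (h' : HasDerivAt G' c z) :
    iteratedDeriv 2 G z = c := by
  rw [iteratedDeriv_succ, iteratedDeriv_one]
  have : deriv G =ᶠ[𝓝 z] G' := h.mono fun w hw => hw.deriv
  rw [this.deriv_eq, h'.deriv]

/-- A holomorphic function on the unit disc whose imaginary part has the sign of `w.im` satisfies
Rogosinski's bound `a₂ ≤ 2 a₁` on its Taylor coefficients, here on the disc of radius `r`. -/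
theorem typicallyReal_coeff_le_of_radius {F F' : ℂ → ℂ} {c : ℂ} {r : ℝ} (hr0 : 0 < r) (hr1 : r < 1)
    (hF : ∀ w ∈ Metric.ball (0 : ℂ) 1, HasDerivAt F (F' w) w) (hF' : HasDerivAt F' c 0)
    (hpos : ∀ w ∈ Metric.ball (0 : ℂ) 1, 0 ≤ w.im * (F w).im) :
    r * c.re ≤ 4 * (F' 0).re := by
  have hrC : (r : ℂ) ≠ 0 := by exact_mod_cast hr0.ne'
  set P : ℂ → ℂ := fun w => r ^ 2 * (-1 + 2 * (w / r) - 2 * (w / r) ^ 3 + (w / r) ^ 4) with hP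
  set P' : ℂ → ℂ := fun w => r * (2 - 6 * (w / r) ^ 2 + 4 * (w / r) ^ 3) with hP'
  have hPd : ∀ w, HasDerivAt P (P' w) w := by
    intro w
    have h1 : HasDerivAt (fun w : ℂ => w / r) (1 / r) w := (hasDerivAt_id w).div_const _
    refine HasDerivAt.congr_deriv (((((h1.const_mul 2).const_add (-1)).sub
      ((h1.pow 3).const_mul 2)).add (h1.pow 4)).const_mul ((r : ℂ) ^ 2)) ?_
    simp only [hP']
    push_cast
    field_simp
    ring
  have hPd' : HasDerivAt P' 0 0 := by
    have h1 : HasDerivAt (fun w : ℂ => w / r) (1 / r) 0 := (hasDerivAt_id _).div_const _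
    refine HasDerivAt.congr_deriv (((((h1.pow 2).const_mul 6).const_sub 2).add
      ((h1.pow 3).const_mul 4)).const_mul (r : ℂ)) ?_
    simp
  have hball : ∀ᶠ w in 𝓝 (0 : ℂ), w ∈ Metric.ball (0 : ℂ) 1 :=
    Metric.isOpen_ball.mem_nhds (by simp)
  have hG := iteratedDeriv_two_eq_of_hasDerivAt (G := fun w => F w * P w)
    (G' := fun w => F' w * P w + F w * P' w)
    (hball.mono fun w hw => (hF w hw).mul (hPd w))
    ((hF'.mul (hPd 0)).add ((hF 0 (by simp)).mul hPd'))
  have hsub : Metric.closedBall (0 : ℂ) r ⊆ Metric.ball 0 1 := Metric.closedBall_subset_ball hr1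
  have hGd : DifferentiableOn ℂ (fun w => F w * P w) (Metric.closedBall (0 : ℂ) r) := fun w hw =>
    ((hF w (hsub hw)).mul (hPd w)).differentiableAt.differentiableWithinAt
  have key := hGd.circleIntegral_one_div_sub_center_pow_smul hr0 2
  have hcI : CircleIntegrable (fun z => (1 / (z - 0) ^ (2 + 1)) • (F z * P z)) 0 r := by
    apply ContinuousOn.circleIntegrable hr0.le
    apply ContinuousOn.fun_smul
    · apply ContinuousOn.div continuousOn_const (by fun_prop)
      intro z hz
      have : z ≠ 0 := Metric.ne_of_mem_sphere hz hr0.ne'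
      simpa using this
    · exact hGd.continuousOn.mono Metric.sphere_subset_closedBall
  have him : 0 ≤ (∮ z in C(0, r), (1 / (z - 0) ^ (2 + 1)) • (F z * P z)).im := by
    rw [circleIntegral]
    have := intervalIntegral.intervalIntegral_im (𝕜 := ℂ) hcI.out
    simp only [RCLike.im_to_complex] at this
    rw [← this]
    apply intervalIntegral.integral_nonneg_of_forall Real.two_pi_pos.le
    intro θ
    set u : ℂ := exp (θ * I) with hu
    have hu1 : ‖u‖ = 1 := norm_exp_ofReal_mul_I θ
    have hu0 : u ≠ 0 := exp_ne_zero _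
    have hm : circleMap 0 r θ = r * u := by simp [circleMap, hu]
    have hmem : (r * u : ℂ) ∈ Metric.ball (0 : ℂ) 1 := by
      simpa [hu1, abs_of_pos hr0] using hr1
    have hd : deriv (circleMap 0 r) θ • (1 / (circleMap 0 r θ - 0) ^ (2 + 1)) •
        (F (circleMap 0 r θ) * P (circleMap 0 r θ)) =
        I * u * (u ^ 3)⁻¹ * (F (r * u) * (-1 + 2 * u - 2 * u ^ 3 + u ^ 4)) := by
      rw [deriv_circleMap, hm]
      simp only [hP, smul_eq_mul, sub_zero, mul_div_cancel_left₀ u hrC, Nat.reduceAdd]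
      field_simp
    rw [hd, Complex.im_unit_circle_kernel_mul u hu1]
    have h1 := hpos _ hmem
    have h2 : u.re ≤ 1 := hu1 ▸ re_le_norm u
    have h3 : 0 ≤ u.im * (F (r * u)).im := by
      rw [im_ofReal_mul, mul_assoc] at h1
      exact nonneg_of_mul_nonneg_right h1 hr0
    have h4 : 0 ≤ 1 - u.re := sub_nonneg.2 h2
    positivity
  rw [key, hG] at him
  have hval : ((2 * Real.pi * I / (Nat.factorial 2 : ℕ) : ℂ) • (c * P 0 + F' 0 * P' 0 +
      (F' 0 * P' 0 + F 0 * 0))) = ((Real.pi * r : ℝ) : ℂ) * (I * (4 * F' 0 - r * c)) := by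
    simp [hP, hP', Nat.factorial]
    ring
  rw [hval, im_ofReal_mul] at him
  have h5 := nonneg_of_mul_nonneg_right him (by positivity)
  simp at h5
  linarith

theorem typicallyReal_coeff_le {F F' : ℂ → ℂ} {c : ℂ}
    (hF : ∀ w ∈ Metric.ball (0 : ℂ) 1, HasDerivAt F (F' w) w) (hF' : HasDerivAt F' c 0)
    (hpos : ∀ w ∈ Metric.ball (0 : ℂ) 1, 0 ≤ w.im * (F w).im) :
    c.re ≤ 4 * (F' 0).re := by
  have ht : Tendsto (fun r : ℝ => r * c.re) (𝓝[<] 1) (𝓝 (1 * c.re)) :=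
    ((continuous_id.mul continuous_const).tendsto 1).mono_left nhdsWithin_le_nhds
  rw [one_mul] at ht
  refine le_of_tendsto ht ?_
  filter_upwards [Ioo_mem_nhdsLT (show (0 : ℝ) < 1 by norm_num)] with r hr
  exact typicallyReal_coeff_le_of_radius hr.1 hr.2 hF hF' hpos

theorem mem_Omega_iff {s t : ℝ} {z : ℂ} : z ∈ Omega s t ↔ z.im ≠ 0 ∨ s < z.re ∧ z.re < t := by
  constructor
  · rintro ((h | h) | ⟨x, hx, rfl⟩)
    · exact Or.inl (ne_of_gt h)
    · exact Or.inl (ne_of_lt h)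
    · exact Or.inr hx
  · intro h
    rcases lt_trichotomy z.im 0 with h0 | h0 | h0
    · exact Or.inl (Or.inr h0)
    · refine Or.inr ⟨z.re, h.resolve_left (not_not.2 h0), ?_⟩
      apply Complex.ext <;> simp [h0]
    · exact Or.inl (Or.inl h0)

theorem isOpen_Omega (s t : ℝ) : IsOpen (Omega s t) := by
  have : Omega s t = {z : ℂ | z.im ≠ 0} ∪ ({z | s < z.re} ∩ {z | z.re < t}) := by
    ext z
    exact mem_Omega_iff
  rw [this]
  exact (isOpen_ne_fun continuous_im continuous_const).union
    ((isOpen_lt continuous_const continuous_re).inter (isOpen_lt continuous_re continuous_const))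

theorem Herglotzian.im_mul_im_nonneg {s t : ℝ} {f : ℂ → ℂ} (hf : Herglotzian s t f) {z : ℂ}
    (hz : z ∈ Omega s t) : 0 ≤ z.im * (f z).im := by
  rcases lt_trichotomy z.im 0 with h0 | h0 | h0
  · have hc : starRingEnd ℂ z ∈ Omega s t := by
      rw [mem_Omega_iff]
      left
      simpa using h0.ne
    have h := hf.2.2 _ hc (by simpa using h0)
    rw [hf.2.1 z hz, conj_im] at h
    exact mul_nonneg_of_nonpos_of_nonpos h0.le (by linarith)
  · simp [h0]
  · exact mul_nonneg h0.le (hf.2.2 z hz h0)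

/-- The denominator of the conformal map of the unit disc onto a doubly slit plane does not
vanish in the disc. -/
theorem one_add_mul_add_sq_ne_zero {p : ℝ} (hp : p ^ 2 < 4) {w : ℂ} (hw : ‖w‖ < 1) :
    1 + p * w + w ^ 2 ≠ 0 := by
  intro h
  have hn : w.re ^ 2 + w.im ^ 2 < 1 := by
    have : ‖w‖ ^ 2 < 1 := by nlinarith [norm_nonneg w]
    rw [← normSq_eq_norm_sq, normSq_apply] at this
    linarith
  have hre := congrArg re h
  have him := congrArg im h
  simp [pow_two] at hre him
  have h0 : w.im * (1 - (w.re ^ 2 + w.im ^ 2)) = 0 := by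
    linear_combination w.im * hre - w.re * him
  rcases mul_eq_zero.1 h0 with h1 | h1
  · rw [h1] at hre
    nlinarith [sq_nonneg (w.re + p / 2)]
  · linarith

/-- The map `w ↦ x + c w / (1 + p w + w²)` with `c = 4ml / (m + l)` and `p = 2(l - m) / (l + m)`
sends the unit disc into `Omega (x - l) (x + m)`, with imaginary part of the sign of `w.im`. -/
theorem slitPlane_map_mem_Omega {x l m c p : ℝ} (hm : 0 < m) (hl : 0 < l) (hc : 0 < c)
    (hcm : c = m * (2 + p)) (hcl : c = l * (2 - p)) {w : ℂ} (hw : ‖w‖ < 1) :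
    x + c * w / (1 + p * w + w ^ 2) ∈ Omega (x - l) (x + m) ∧
      ∃ k : ℝ, 0 < k ∧ ((x : ℂ) + c * w / (1 + p * w + w ^ 2)).im = k * w.im := by
  have hp1 : 0 < 2 + p := pos_of_mul_pos_right (hcm ▸ hc) hm.le
  have hp2 : 0 < 2 - p := pos_of_mul_pos_right (hcl ▸ hc) hl.le
  have hp : p ^ 2 < 4 := by nlinarith [mul_pos hp1 hp2]
  have hD := one_add_mul_add_sq_ne_zero hp hw
  have hn : w.re ^ 2 + w.im ^ 2 < 1 := by
    have : ‖w‖ ^ 2 < 1 := by nlinarith [norm_nonneg w]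
    rw [← normSq_eq_norm_sq, normSq_apply] at this
    linarith
  have hN : 0 < normSq (1 + p * w + w ^ 2) := normSq_pos.2 hD
  have him : ((x : ℂ) + c * w / (1 + p * w + w ^ 2)).im =
      (c * (1 - (w.re ^ 2 + w.im ^ 2)) / normSq (1 + p * w + w ^ 2)) * w.im := by
    rw [add_im, ofReal_im, zero_add, div_im]
    field_simp
    simp [pow_two]
    ring
  have hk : 0 < c * (1 - (w.re ^ 2 + w.im ^ 2)) / normSq (1 + p * w + w ^ 2) :=
    div_pos (mul_pos hc (by linarith)) hN
  refine ⟨?_, _, hk, him⟩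
  rw [mem_Omega_iff]
  by_cases h0 : w.im = 0
  · right
    obtain ⟨y, rfl⟩ : ∃ y : ℝ, w = y := ⟨w.re, by apply Complex.ext <;> simp [h0]⟩
    simp only [ofReal_re, ofReal_im] at hn
    have hy : y ^ 2 < 1 := by linarith
    have hy1 : y < 1 := by nlinarith
    have hy2 : -1 < y := by nlinarith
    have hd : 0 < 1 + p * y + y ^ 2 := by nlinarith [sq_nonneg (y + p / 2)]
    have he : ((x : ℂ) + c * y / (1 + p * y + (y : ℂ) ^ 2)).re =
        x + c * y / (1 + p * y + y ^ 2) := by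
      rw [← ofReal_re (x + c * y / (1 + p * y + y ^ 2))]
      push_cast
      rfl
    rw [he]
    constructor
    · have : -l < c * y / (1 + p * y + y ^ 2) := by
        rw [lt_div_iff₀ hd, hcl]
        have : 0 < l * (1 + y) ^ 2 := mul_pos hl (pow_pos (by linarith) 2)
        nlinarith
      linarith
    · have : c * y / (1 + p * y + y ^ 2) < m := by
        rw [div_lt_iff₀ hd, hcm]
        have : 0 < m * (1 - y) ^ 2 := mul_pos hm (pow_pos (by linarith) 2)
        nlinarith
      linarith
  · left
    rw [him]
    exact mul_ne_zero hk.ne' h0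

theorem Herglotzian.deriv_deriv_re_le {A B x : ℝ} {f : ℂ → ℂ} (hf : Herglotzian A B f)
    (hA : A < x) (hB : x < B) :
    (B - x) * (deriv (deriv f) x).re ≤ 2 * (deriv f x).re := by
  obtain ⟨l, hl⟩ : ∃ l, l = x - A := ⟨_, rfl⟩
  obtain ⟨m, hm⟩ : ∃ m, m = B - x := ⟨_, rfl⟩
  have hl0 : 0 < l := by linarith
  have hm0 : 0 < m := by linarith
  obtain ⟨c, hc⟩ : ∃ c, c = 4 * m * l / (m + l) := ⟨_, rfl⟩
  obtain ⟨p, hp⟩ : ∃ p, p = 2 * (l - m) / (m + l) := ⟨_, rfl⟩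
  have hc0 : 0 < c := by rw [hc]; positivity
  have hcm : c = m * (2 + p) := by rw [hc, hp]; field_simp; ring
  have hcl : c = l * (2 - p) := by rw [hc, hp]; field_simp; ring
  have hp4 : p ^ 2 < 4 := by
    have hp1 : 0 < 2 + p := pos_of_mul_pos_right (hcm ▸ hc0) hm0.le
    have hp2 : 0 < 2 - p := pos_of_mul_pos_right (hcl ▸ hc0) hl0.le
    nlinarith [mul_pos hp1 hp2]
  have hmap : ∀ w ∈ Metric.ball (0 : ℂ) 1, x + c * w / (1 + p * w + w ^ 2) ∈ Omega A B ∧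
      ∃ k : ℝ, 0 < k ∧ ((x : ℂ) + c * w / (1 + p * w + w ^ 2)).im = k * w.im := by
    intro w hw
    have h := slitPlane_map_mem_Omega (x := x) hm0 hl0 hc0 hcm hcl (mem_ball_zero_iff.1 hw)
    rwa [hl, hm, sub_sub_cancel, add_sub_cancel] at h
  have hfd : ∀ z ∈ Omega A B, HasDerivAt f (deriv f z) z := fun z hz =>
    (hf.1.differentiableAt ((isOpen_Omega A B).mem_nhds hz)).hasDerivAt
  have hfd' : ∀ z ∈ Omega A B, HasDerivAt (deriv f) (deriv (deriv f) z) z := fun z hz =>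
    ((hf.1.deriv (isOpen_Omega A B)).differentiableAt
      ((isOpen_Omega A B).mem_nhds hz)).hasDerivAt
  set φ : ℂ → ℂ := fun w => x + c * w / (1 + p * w + w ^ 2) with hφ
  set φ' : ℂ → ℂ := fun w => c * (1 - w ^ 2) / (1 + p * w + w ^ 2) ^ 2 with hφ'
  have hden : ∀ w : ℂ, HasDerivAt (fun w : ℂ => 1 + p * w + w ^ 2) (p + 2 * w) w := by
    intro w
    refine ((((hasDerivAt_id w).const_mul (p : ℂ)).const_add 1).add
      ((hasDerivAt_id w).pow 2)).congr_deriv ?_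
    simp
  have hφd : ∀ w ∈ Metric.ball (0 : ℂ) 1, HasDerivAt φ (φ' w) w := by
    intro w hw
    have hD := one_add_mul_add_sq_ne_zero hp4 (mem_ball_zero_iff.1 hw)
    refine ((((hasDerivAt_id w).const_mul (c : ℂ)).div (hden w) hD).const_add
      (x : ℂ)).congr_deriv ?_
    simp only [hφ', id]
    congr 1
    ring
  have hφd' : HasDerivAt φ' (-(2 * p * c)) 0 := by
    refine (((((hasDerivAt_id (0 : ℂ)).pow 2).const_sub 1).const_mul (c : ℂ)).div
      ((hden 0).pow 2) (by simp)).congr_deriv ?_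
    simp
    ring
  have h0 : φ 0 = x := by simp [hφ]
  have h0' : φ' 0 = c := by simp [hφ']
  have hx : (x : ℂ) ∈ Omega A B := mem_Omega_iff.2 (Or.inr ⟨by simpa, by simpa⟩)
  have h := typicallyReal_coeff_le (F := fun w => f (φ w)) (F' := fun w => deriv f (φ w) * φ' w)
    (c := deriv (deriv f) x * c * c + deriv f x * -(2 * p * c))
    (fun w hw => (hfd _ (hmap w hw).1).comp w (hφd w hw))
    (by
      have h1 : HasDerivAt (fun w => deriv f (φ w)) (deriv (deriv f) x * c) 0 := by
        have h2 := HasDerivAt.comp (0 : ℂ) (h₂ := deriv f) (by rw [h0]; exact hfd' _ hx)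
          (hφd 0 (by simp))
        rwa [h0'] at h2
      refine (h1.mul hφd').congr_deriv ?_
      rw [h0, h0'])
    (fun w hw => by
      obtain ⟨hmem, k, hk, hkw⟩ := hmap w hw
      have h3 := hf.im_mul_im_nonneg hmem
      rw [hkw, mul_assoc] at h3
      exact nonneg_of_mul_nonneg_right h3 hk)
  simp only [h0, h0'] at h
  have e : deriv (deriv f) x * c * c + deriv f x * -(2 * p * c) =
      deriv (deriv f) x * ((c * c : ℝ) : ℂ) - deriv f x * ((2 * p * c : ℝ) : ℂ) := by
    push_cast
    ring
  rw [e, sub_re, re_mul_ofReal, re_mul_ofReal, re_mul_ofReal] at h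
  rw [← hm]
  have hp1 : 0 < 2 + p := pos_of_mul_pos_right (hcm ▸ hc0) hm0.le
  have hq : 0 ≤ (c * (2 + p)) *
      (2 * (deriv f x).re - m * (deriv (deriv f) x).re) := by
    have : m * (2 + p) * c * (deriv (deriv f) x).re = c * c * (deriv (deriv f) x).re := by
      rw [← hcm]
    nlinarith
  have := nonneg_of_mul_nonneg_right hq (by positivity)
  linarith

theorem Herglotzian.concaveOn {A B : ℝ} {f : ℂ → ℂ} (hf : Herglotzian A B f) :
    ConcaveOn ℝ (Ioo A B) fun x : ℝ => (B - x) * (f x).re := by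
  have hmem : ∀ x ∈ Ioo A B, (x : ℂ) ∈ Omega A B := fun x hx => Or.inr ⟨x, hx, rfl⟩
  have hfd : ∀ x ∈ Ioo A B, HasDerivAt (fun x : ℝ => (f x).re) (deriv f x).re x := fun x hx =>
    (hf.1.differentiableAt ((isOpen_Omega A B).mem_nhds
      (hmem x hx))).hasDerivAt.real_of_complex
  have hfd' : ∀ x ∈ Ioo A B, HasDerivAt (fun x : ℝ => (deriv f x).re)
      (deriv (deriv f) x).re x := fun x hx =>
    ((hf.1.deriv (isOpen_Omega A B)).differentiableAt ((isOpen_Omega A B).mem_nhds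
      (hmem x hx))).hasDerivAt.real_of_complex
  have hs : ∀ x : ℝ, HasDerivAt (fun x : ℝ => B - x) (-1) x := fun x =>
    (hasDerivAt_id x).const_sub B
  have hg : ∀ x ∈ Ioo A B, HasDerivAt (fun x : ℝ => (B - x) * (f x).re)
      (-1 * (f x).re + (B - x) * (deriv f x).re) x := fun x hx => (hs x).mul (hfd x hx)
  have hg' : ∀ x ∈ Ioo A B, HasDerivAt (deriv fun x : ℝ => (B - x) * (f x).re)
      (-1 * (deriv f x).re + (-1 * (deriv f x).re + (B - x) * (deriv (deriv f) x).re)) x := by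
    intro x hx
    have he : (deriv fun x : ℝ => (B - x) * (f x).re) =ᶠ[𝓝 x]
        fun x => -1 * (f x).re + (B - x) * (deriv f x).re := by
      filter_upwards [isOpen_Ioo.mem_nhds hx] with y hy using (hg y hy).deriv
    exact HasDerivAt.congr_of_eventuallyEq
      (((hfd x hx).const_mul (-1)).add ((hs x).mul (hfd' x hx))) he
  refine concaveOn_of_deriv2_nonpos' (convex_Ioo A B)
    (fun x hx => (hg x hx).differentiableAt.differentiableWithinAt)
    (fun x hx => (hg' x hx).differentiableAt.differentiableWithinAt) fun x hx => ?_
  rw [Function.iterate_succ_apply, Function.iterate_one, (hg' x hx).deriv]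
  linarith [hf.deriv_deriv_re_le hx.1 hx.2]

/-- Lemma 1 (noses): a Herglotz function on `Omega A B` satisfies, at each
real `z ∈ (a,b)` with `A < a < b < B`, the stated convexity-type lower bound. -/
theorem herglotz_lower_bound (A a b B : ℝ) (hAa : A < a) (hab : a < b) (hbB : b < B)
    (f : ℂ → ℂ) (hf : Herglotzian A B f) :
    ∀ z ∈ Set.Ioo a b,
      ((B - b) * (z - a) * (f (b:ℂ)).re + (B - a) * (b - z) * (f (a:ℂ)).re) /
        ((b - a) * (B - z)) ≤ (f (z:ℂ)).re := by
  intro z hz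
  obtain ⟨haz, hzb⟩ := hz
  have hba : 0 < b - a := by linarith
  have hBz : 0 < B - z := by linarith
  have h := hf.concaveOn.2 (show a ∈ Ioo A B from ⟨hAa, hab.trans hbB⟩)
    (show b ∈ Ioo A B from ⟨hAa.trans hab, hbB⟩)
    (div_nonneg (sub_nonneg.2 hzb.le) hba.le) (div_nonneg (sub_nonneg.2 haz.le) hba.le)
    (by field_simp; ring)
  have e : ((b - z) / (b - a)) • a + ((z - a) / (b - a)) • b = z := by
    simp only [smul_eq_mul]
    field_simp
    ring
  rw [e] at h
  simp only [smul_eq_mul] at h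
  rw [div_le_iff₀ (mul_pos hba hBz)]
  have h' := mul_le_mul_of_nonneg_left h hba.le
  have e2 : (b - a) * ((b - z) / (b - a) * ((B - a) * (f a).re) +
      (z - a) / (b - a) * ((B - b) * (f b).re)) =
      (B - b) * (z - a) * (f b).re + (B - a) * (b - z) * (f a).re := by
    field_simp
    ring
  rw [e2] at h'
  linarith
end
end

section
/- Let a < b be real numbers and let f be a non-constant Herglotzian function holomorphic in Ω(a, b). Then f′(x) > 0 for every x ∈ (a, b), and for every z ∈ (a, b) one has −2/(z−a) ≤ f″(z)/f′(z) ≤ 2/(b−z). -/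
open Complex Set

noncomputable section

/-- Pairing a holomorphic function with the trigonometric kernel `sin θ (1 + s cos θ)`
on a circle picks out its first two derivatives at the centre. -/
lemma circleIntegral_kernel_mul {g : ℂ → ℂ} {r : ℝ} (hr : 0 < r) (s : ℂ)
    (hg : DifferentiableOn ℂ g (Metric.closedBall 0 r)) :
    (∮ w in C(0, r), (1 / r - r / w ^ 2 + s * (w / r ^ 2 - r ^ 2 / w ^ 3) / 2) * g w) =
      -2 * Real.pi * I * (r * deriv g 0 + s * r ^ 2 / 4 * deriv (deriv g) 0) := by
  have h1 : (∮ w in C(0, r), (1 / r + s * w / r ^ 2 / 2) * g w) = 0 := by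
    refine DiffContOnCl.circleIntegral_eq_zero hr.le ?_
    refine DifferentiableOn.diffContOnCl ?_
    refine DifferentiableOn.mono (t := Metric.closedBall 0 r) ?_ Metric.closure_ball_subset_closedBall
    exact DifferentiableOn.mul (by fun_prop) hg
  have h2 := hg.circleIntegral_one_div_sub_center_pow_smul hr 1
  have h3 := hg.circleIntegral_one_div_sub_center_pow_smul hr 2
  have hgc : ContinuousOn g (Metric.sphere 0 r) :=
    hg.continuousOn.mono Metric.sphere_subset_closedBall
  have hne : ∀ w ∈ Metric.sphere (0 : ℂ) r, w ≠ 0 := fun w hw =>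
    ne_zero_of_mem_sphere hr.ne' ⟨w, hw⟩
  have i1 : CircleIntegrable (fun w => (1 / r + s * w / r ^ 2 / 2) * g w) 0 r :=
    ContinuousOn.circleIntegrable hr.le (ContinuousOn.mul (by fun_prop) hgc)
  have i2 : ∀ (d : ℂ) (n : ℕ), CircleIntegrable (fun w => d • (1 / (w - 0) ^ n) • g w) 0 r :=
    fun d n => by
      have h : ContinuousOn (fun w : ℂ => 1 / (w - 0) ^ n) (Metric.sphere 0 r) :=
        ContinuousOn.div (by fun_prop) (by fun_prop) fun w hw => by
          simpa using fun h => absurd h (hne w hw)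
      exact ((h.smul hgc).const_smul d).circleIntegrable hr.le
  have key : (∮ w in C(0, r), (1 / r - r / w ^ 2 + s * (w / r ^ 2 - r ^ 2 / w ^ 3) / 2) * g w) =
      ∮ w in C(0, r), ((1 / r + s * w / r ^ 2 / 2) * g w +
        ((-(r : ℂ)) • (1 / (w - 0) ^ 2) • g w + (-(s * r ^ 2 / 2)) • (1 / (w - 0) ^ 3) • g w)) := by
    congr 1
    funext w
    simp only [smul_eq_mul, sub_zero]
    ring
  have i3 : CircleIntegrable (fun w => (-(r : ℂ)) • (1 / (w - 0) ^ 2) • g w +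
      (-(s * r ^ 2 / 2)) • (1 / (w - 0) ^ 3) • g w) 0 r := (i2 _ 2).add (i2 _ 3)
  rw [key, circleIntegral.integral_add i1 i3, circleIntegral.integral_add (i2 _ 2) (i2 _ 3), circleIntegral.integral_smul,
    circleIntegral.integral_smul, h1, h2, h3]
  simp only [iteratedDeriv_succ, iteratedDeriv_zero, smul_eq_mul, Nat.factorial]
  push_cast
  ring

/-- On the circle, the kernel of `circleIntegral_kernel_mul` is a real trigonometric polynomial. -/
lemma circleMap_mul_kernel {r : ℝ} (hr : r ≠ 0) (s : ℂ) (θ : ℝ) :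
    circleMap 0 r θ * I * (1 / r - r / circleMap 0 r θ ^ 2 +
        s * (circleMap 0 r θ / r ^ 2 - r ^ 2 / circleMap 0 r θ ^ 3) / 2) =
      -2 * Real.sin θ * (1 + s * Real.cos θ) := by
  have hr' : (r : ℂ) ≠ 0 := by exact_mod_cast hr
  have hcs : Complex.cos θ ^ 2 + Complex.sin θ ^ 2 = 1 := Complex.cos_sq_add_sin_sq _
  have huv : (Complex.cos θ + Complex.sin θ * I) * (Complex.cos θ - Complex.sin θ * I) = 1 := by
    linear_combination hcs - Complex.sin θ ^ 2 * Complex.I_sq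
  rw [circleMap_zero, Complex.exp_mul_I, Complex.ofReal_sin, Complex.ofReal_cos]
  generalize hu : Complex.cos θ + Complex.sin θ * I = u at *
  generalize hv : Complex.cos θ - Complex.sin θ * I = v at *
  have hc : Complex.cos θ = (u + v) / 2 := by rw [← hu, ← hv]; ring
  have hs : Complex.sin θ = -I * (u - v) / 2 := by
    rw [← hu, ← hv]; linear_combination Complex.sin θ * Complex.I_sq
  have hu0 : u ≠ 0 := left_ne_zero_of_mul_eq_one huv
  obtain rfl : v = u⁻¹ := eq_inv_of_mul_eq_one_right huv
  rw [hc, hs]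
  field_simp
  ring

lemma re_deriv_add_pos {g : ℂ → ℂ} {r s : ℝ} (hr : 0 < r) (hs : |s| ≤ 1)
    (hg : DifferentiableOn ℂ g (Metric.closedBall 0 r))
    (hp : ∀ w ∈ Metric.closedBall (0 : ℂ) r, 0 < w.im → 0 < (g w).im)
    (hm : ∀ w ∈ Metric.closedBall (0 : ℂ) r, w.im < 0 → (g w).im ≤ 0) :
    0 < (deriv g 0).re + s * r / 4 * (deriv (deriv g) 0).re := by
  have hK := circleIntegral_kernel_mul hr s hg
  have hmem : ∀ θ : ℝ, circleMap 0 r θ ∈ Metric.closedBall (0 : ℂ) r := fun θ =>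
    circleMap_mem_closedBall _ hr.le θ
  have him : ∀ θ : ℝ, (circleMap 0 r θ).im = r * Real.sin θ := fun θ => by
    simp [circleMap_zero, Complex.exp_im]
  have hcont : Continuous fun θ : ℝ => g (circleMap 0 r θ) :=
    hg.continuousOn.comp_continuous (continuous_circleMap 0 r) hmem
  have hint : (∮ w in C(0, r), (1 / r - r / w ^ 2 + s * (w / r ^ 2 - r ^ 2 / w ^ 3) / 2) * g w) =
      ∫ θ in (0 : ℝ)..2 * Real.pi,
        ((-2 * Real.sin θ * (1 + s * Real.cos θ) : ℝ) : ℂ) * g (circleMap 0 r θ) := by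
    rw [circleIntegral]
    congr 1
    funext θ
    rw [deriv_circleMap, smul_eq_mul, ← mul_assoc, circleMap_mul_kernel hr.ne']
    push_cast
    rfl
  have hIm : (∫ θ in (0 : ℝ)..2 * Real.pi,
        ((-2 * Real.sin θ * (1 + s * Real.cos θ) : ℝ) : ℂ) * g (circleMap 0 r θ)).im =
      ∫ θ in (0 : ℝ)..2 * Real.pi,
        (-2 * Real.sin θ * (1 + s * Real.cos θ)) * (g (circleMap 0 r θ)).im := by
    have := Complex.imCLM.intervalIntegral_comp_comm (μ := MeasureTheory.volume)
      (a := 0) (b := 2 * Real.pi)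
      (f := fun θ : ℝ => ((-2 * Real.sin θ * (1 + s * Real.cos θ) : ℝ) : ℂ) *
        g (circleMap 0 r θ)) (Continuous.intervalIntegrable
        ((Complex.continuous_ofReal.comp (by fun_prop)).mul hcont) _ _)
    simp only [Complex.imCLM_apply, Complex.im_ofReal_mul] at this
    exact this.symm
  have hpos : 0 < ∫ θ in (0 : ℝ)..2 * Real.pi,
      (2 * Real.sin θ * (1 + s * Real.cos θ)) * (g (circleMap 0 r θ)).im := by
    refine intervalIntegral.integral_pos (by positivity) ?_ ?_ ?_
    · have := Complex.continuous_im.comp hcont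
      exact Continuous.continuousOn (by fun_prop)
    · intro θ _
      have h1 : 0 ≤ 1 + s * Real.cos θ := by
        have : |s * Real.cos θ| ≤ 1 := by
          rw [abs_mul]
          exact mul_le_one₀ hs (abs_nonneg _) (Real.abs_cos_le_one θ)
        linarith [(abs_le.mp this).1]
      have h2 : 0 ≤ Real.sin θ * (g (circleMap 0 r θ)).im := by
        rcases lt_trichotomy (Real.sin θ) 0 with h | h | h
        · exact mul_nonneg_of_nonpos_of_nonpos h.le
            (hm _ (hmem θ) (by rw [him]; exact mul_neg_of_pos_of_neg hr h))
        · simp [h]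
        · exact mul_nonneg h.le (hp _ (hmem θ) (by rw [him]; positivity)).le
      calc (0 : ℝ) ≤ 2 * ((1 + s * Real.cos θ) *
            (Real.sin θ * (g (circleMap 0 r θ)).im)) := by positivity
        _ = _ := by ring
    · refine ⟨Real.pi / 2, ⟨by positivity, by linarith [Real.pi_pos]⟩, ?_⟩
      have := hp _ (hmem (Real.pi / 2)) (by rw [him]; simpa using hr)
      simpa using this
  have hneg : (∫ θ in (0 : ℝ)..2 * Real.pi,
        (-2 * Real.sin θ * (1 + s * Real.cos θ)) * (g (circleMap 0 r θ)).im) =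
      -∫ θ in (0 : ℝ)..2 * Real.pi,
      (2 * Real.sin θ * (1 + s * Real.cos θ)) * (g (circleMap 0 r θ)).im := by
    rw [← intervalIntegral.integral_neg]
    congr 1
    funext θ
    ring
  have hR : (-2 * Real.pi * I * (r * deriv g 0 + s * r ^ 2 / 4 * deriv (deriv g) 0)).im =
      -(2 * Real.pi * r * ((deriv g 0).re + s * r / 4 * (deriv (deriv g) 0).re)) := by
    have : -2 * Real.pi * I * (r * deriv g 0 + s * r ^ 2 / 4 * deriv (deriv g) 0) =
      ((-2 * Real.pi : ℝ) : ℂ) * (I * (((r : ℝ) : ℂ) * deriv g 0 +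
        ((s * r ^ 2 / 4 : ℝ) : ℂ) * deriv (deriv g) 0)) := by push_cast; ring
    rw [this, Complex.im_ofReal_mul, Complex.I_mul_im, Complex.add_re, Complex.re_ofReal_mul,
      Complex.re_ofReal_mul]
    ring
  rw [hint] at hK
  have hfin := congrArg Complex.im hK
  rw [hIm, hneg, hR, neg_inj] at hfin
  rw [hfin] at hpos
  exact pos_of_mul_pos_right hpos (by positivity)

/-- Rogosinski's bound for the second coefficient of a typically real function. -/
lemma typicallyReal_second_deriv_bound {g : ℂ → ℂ}
    (hg : DifferentiableOn ℂ g (Metric.ball 0 1))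
    (hp : ∀ w ∈ Metric.ball (0 : ℂ) 1, 0 < w.im → 0 < (g w).im)
    (hm : ∀ w ∈ Metric.ball (0 : ℂ) 1, w.im < 0 → (g w).im ≤ 0) :
    0 < (deriv g 0).re ∧ |(deriv (deriv g) 0).re| ≤ 4 * (deriv g 0).re := by
  have key : ∀ r : ℝ, 0 < r → r < 1 → ∀ s : ℝ, |s| ≤ 1 →
      0 < (deriv g 0).re + s * r / 4 * (deriv (deriv g) 0).re := fun r hr hr1 s hs => by
    have hsub : Metric.closedBall (0 : ℂ) r ⊆ Metric.ball 0 1 :=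
      Metric.closedBall_subset_ball hr1
    exact re_deriv_add_pos hr hs (hg.mono hsub) (fun w hw => hp w (hsub hw))
      fun w hw => hm w (hsub hw)
  have h0 : 0 < (deriv g 0).re := by simpa using key (1 / 2) (by norm_num) (by norm_num) 0 (by simp)
  refine ⟨h0, ?_⟩
  by_contra! h
  set A := (deriv g 0).re
  set B := (deriv (deriv g) 0).re
  have hB : 0 < |B| := by linarith
  have hr : 4 * A / |B| < 1 := (div_lt_one hB).mpr h
  rcases abs_cases B with ⟨hab, _⟩ | ⟨hab, _⟩
  · have := key (4 * A / |B|) (by positivity) hr (-1) (by simp)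
    rw [show A + -1 * (4 * A / |B|) / 4 * B = A - A * (B / |B|) by ring, hab,
      div_self (by linarith)] at this
    linarith
  · have := key (4 * A / |B|) (by positivity) hr 1 (by simp)
    rw [show A + 1 * (4 * A / |B|) / 4 * B = A + A * (B / |B|) by ring, hab, div_neg,
      div_self (by linarith)] at this
    linarith

lemma isOpen_Omega_s5 (a b : ℝ) : IsOpen (Omega a b) := by
  have : Omega a b = UpperHalf ∪ LowerHalf ∪ {z : ℂ | a < z.re ∧ z.re < b} := by
    ext z
    simp only [Omega, UpperHalf, LowerHalf, mem_union, mem_ofPred_eq, mem_image, mem_Ioo]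
    constructor
    · rintro (h | ⟨x, hx, rfl⟩)
      · exact Or.inl h
      · exact Or.inr (by simpa using hx)
    · rintro (h | h)
      · exact Or.inl h
      · rcases lt_trichotomy z.im 0 with hz | hz | hz
        · exact Or.inl (Or.inr hz)
        · exact Or.inr ⟨z.re, h, Complex.ext (by simp) (by simp [hz])⟩
        · exact Or.inl (Or.inl hz)
  rw [this]
  refine IsOpen.union (IsOpen.union ?_ ?_) (IsOpen.and ?_ ?_)
  · exact isOpen_lt continuous_const Complex.continuous_im
  · exact isOpen_lt Complex.continuous_im continuous_const
  · exact isOpen_lt continuous_const Complex.continuous_re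
  · exact isOpen_lt Complex.continuous_re continuous_const

lemma isPreconnected_Omega {a b : ℝ} (hab : a < b) : IsPreconnected (Omega a b) := by
  set m : ℝ := (a + b) / 2
  have hm : m ∈ Ioo a b := ⟨by simp only [m]; linarith, by simp only [m]; linarith⟩
  have hstar : StarConvex ℝ (m : ℂ) (Omega a b) := by
    rw [starConvex_iff_segment_subset]
    rintro z hz y ⟨s, t, hs, ht, hst, rfl⟩
    rcases ht.eq_or_lt with rfl | ht
    · obtain rfl : s = 1 := by linarith
      exact Or.inr ⟨m, hm, by simp⟩
    have him : (s • (m : ℂ) + t • z).im = t * z.im := by simp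
    rcases hz with (hz | hz) | ⟨x, hx, rfl⟩
    · exact Or.inl (Or.inl (by
        change 0 < (s • (m : ℂ) + t • z).im
        rw [him]; exact mul_pos ht hz))
    · exact Or.inl (Or.inr (by
        change (s • (m : ℂ) + t • z).im < 0
        rw [him]; exact mul_neg_of_pos_of_neg ht hz))
    · exact Or.inr ⟨s * m + t * x, (convex_Ioo a b) hm hx hs ht.le hst, by simp⟩
  exact (hstar.isPathConnected (Or.inr ⟨m, hm, rfl⟩)).isConnected.isPreconnected

lemma conj_mem_Omega {a b : ℝ} {z : ℂ} (hz : z ∈ Omega a b) :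
    starRingEnd ℂ z ∈ Omega a b := by
  rcases hz with (hz | hz) | ⟨x, hx, rfl⟩
  · exact Or.inl (Or.inr (by simpa [LowerHalf, UpperHalf] using hz))
  · exact Or.inl (Or.inl (by simpa [LowerHalf, UpperHalf] using hz))
  · exact Or.inr ⟨x, hx, by simp⟩

lemma Herglotzian.im_pos {a b : ℝ} (hab : a < b) {f : ℂ → ℂ} (hf : Herglotzian a b f)
    (hnc : ∃ z ∈ Omega a b, ∃ w ∈ Omega a b, f z ≠ f w) {z : ℂ} (hz : 0 < z.im) :
    0 < (f z).im := by
  have hsub : UpperHalf ⊆ Omega a b := fun w hw => Or.inl (Or.inl hw)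
  have hU : IsOpen UpperHalf := isOpen_lt continuous_const Complex.continuous_im
  rcases (hf.1.analyticOnNhd (isOpen_Omega_s5 a b)).is_constant_or_isOpen
    (isPreconnected_Omega hab) with ⟨c, hc⟩ | h
  · obtain ⟨z, hz, w, hw, hzw⟩ := hnc
    exact absurd ((hc z hz).trans (hc w hw).symm) hzw
  · have hopen := h UpperHalf hsub hU
    have himg : f '' UpperHalf ⊆ {w : ℂ | 0 ≤ w.im} := by
      rintro _ ⟨w, hw, rfl⟩
      exact hf.2.2 w (hsub hw) hw
    have := hopen.subset_interior_iff.mpr himg (mem_image_of_mem f (show z ∈ UpperHalf from hz))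
    rwa [Complex.interior_setOfPred_le_im] at this

lemma Herglotzian.im_deriv_eq_zero {a b : ℝ} {f : ℂ → ℂ} (hf : Herglotzian a b f)
    {x : ℝ} (hx : x ∈ Ioo a b) : (deriv f (x : ℂ)).im = 0 := by
  have hxΩ : (x : ℂ) ∈ Omega a b := Or.inr ⟨x, hx, rfl⟩
  have hn := (isOpen_Omega_s5 a b).mem_nhds hxΩ
  have hd := (hf.1.differentiableAt hn).hasDerivAt
  have hcc := hd.conj_conj
  rw [Complex.conj_ofReal] at hcc
  have heq : (starRingEnd ℂ ∘ f ∘ starRingEnd ℂ) =ᶠ[nhds (x : ℂ)] f := by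
    filter_upwards [hn] with z hz
    simp [hf.2.1 z hz]
  exact Complex.conj_eq_iff_im.mp ((hcc.congr_of_eventuallyEq heq.symm).unique hd)

/-- A Möbius image of the Joukowski map `w ↦ w + 1 / w`: for suitable `c`, `k` it sends the unit
disc onto a doubly slit plane, with `0 ↦ x`. -/
def slitMap (x c k : ℝ) (w : ℂ) : ℂ := x + c * w / (1 + k * w + w ^ 2)

lemma slitMap_denom_ne_zero {k : ℝ} (hk : |k| < 2) {w : ℂ} (hw : w ∈ Metric.ball (0 : ℂ) 1) :
    1 + k * w + w ^ 2 ≠ 0 := by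
  have hn : w.re ^ 2 + w.im ^ 2 < 1 := by
    have h1 : ‖w‖ < 1 := by simpa using hw
    have h2 := Complex.sq_norm w
    rw [Complex.normSq_apply] at h2
    nlinarith [norm_nonneg w]
  obtain ⟨hk1, hk2⟩ := abs_lt.mp hk
  intro h
  have hre := congrArg Complex.re h
  have him := congrArg Complex.im h
  simp [pow_two] at hre him
  have : w.im * (k + 2 * w.re) = 0 := by linarith
  rcases mul_eq_zero.mp this with h0 | h0
  · rw [h0] at hre
    nlinarith [sq_nonneg (w.re + k / 2)]
  · have : k = -2 * w.re := by linarith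
    rw [this] at hre
    nlinarith

lemma slitMap_im (x c k : ℝ) (w : ℂ) :
    (slitMap x c k w).im = c * w.im * (1 - ‖w‖ ^ 2) / Complex.normSq (1 + k * w + w ^ 2) := by
  rw [slitMap, Complex.sq_norm, Complex.add_im, Complex.ofReal_im, Complex.div_im,
    Complex.normSq_apply w]
  simp [pow_two]
  ring

lemma hasDerivAt_slitMap (x c : ℝ) {k : ℝ} {w : ℂ} (hw : 1 + k * w + w ^ 2 ≠ 0) :
    HasDerivAt (slitMap x c k) (c * (1 - w ^ 2) / (1 + k * w + w ^ 2) ^ 2) w := by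
  have h1 : HasDerivAt (fun w : ℂ => (c : ℂ) * w) c w := by
    simpa using (hasDerivAt_id w).const_mul (c : ℂ)
  have h2 : HasDerivAt (fun w : ℂ => 1 + k * w + w ^ 2) (k + 2 * w) w := by
    have := (((hasDerivAt_id w).const_mul (k : ℂ)).const_add 1).fun_add (hasDerivAt_pow 2 w)
    simpa using this
  have h3 := (h1.fun_div h2 hw).const_add (x : ℂ)
  refine HasDerivAt.congr_deriv h3 ?_
  ring

/-- The parameters of `slitMap` adapted to the point `x` of `(x - p, x + q)`. -/
lemma slitMap_mem_Omega {x p q : ℝ} (hp : 0 < p) (hq : 0 < q) {w : ℂ}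
    (hw : w ∈ Metric.ball (0 : ℂ) 1) :
    slitMap x (4 * p * q / (p + q)) (2 * (p - q) / (p + q)) w ∈ Omega (x - p) (x + q) ∧
    (0 < w.im → 0 < (slitMap x (4 * p * q / (p + q)) (2 * (p - q) / (p + q)) w).im) ∧
    (w.im < 0 → (slitMap x (4 * p * q / (p + q)) (2 * (p - q) / (p + q)) w).im < 0) := by
  set c := 4 * p * q / (p + q) with hc
  set k := 2 * (p - q) / (p + q) with hk
  have hc0 : 0 < c := by positivity
  have hk2 : |k| < 2 := by
    rw [hk, abs_lt]
    constructor
    · rw [lt_div_iff₀ (by positivity)]; linarith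
    · rw [div_lt_iff₀ (by positivity)]; linarith
  have hn : ‖w‖ < 1 := by simpa using hw
  have hD : 0 < Complex.normSq (1 + k * w + w ^ 2) :=
    Complex.normSq_pos.mpr (slitMap_denom_ne_zero hk2 hw)
  have hn2 : 0 < 1 - ‖w‖ ^ 2 := by nlinarith [norm_nonneg w]
  have hup : 0 < w.im → 0 < (slitMap x c k w).im := fun h => by
    rw [slitMap_im]; positivity
  have hlo : w.im < 0 → (slitMap x c k w).im < 0 := fun h => by
    rw [slitMap_im]
    exact div_neg_of_neg_of_pos
      (mul_neg_of_neg_of_pos (mul_neg_of_pos_of_neg hc0 h) hn2) hD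
  refine ⟨?_, hup, hlo⟩
  rcases lt_trichotomy w.im 0 with h | h | h
  · exact Or.inl (Or.inr (hlo h))
  · obtain ⟨t, rfl⟩ : ∃ t : ℝ, (t : ℂ) = w := ⟨w.re, Complex.ext (by simp) (by simp [h])⟩
    have ht : |t| < 1 := by simpa using hn
    obtain ⟨ht1, ht2⟩ := abs_lt.mp ht
    obtain ⟨hk3, hk4⟩ := abs_lt.mp hk2
    have hd : 0 < 1 + k * t + t ^ 2 := by nlinarith [sq_nonneg (t + k / 2)]
    refine Or.inr ⟨x + c * t / (1 + k * t + t ^ 2), ⟨?_, ?_⟩, by simp [slitMap]⟩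
    · have hcp : c = p * (2 - k) := by rw [hc, hk]; field_simp; ring
      have : -p < c * t / (1 + k * t + t ^ 2) := by
        rw [lt_div_iff₀ hd, hcp]
        nlinarith [mul_pos hp (pow_pos (show 0 < 1 + t by linarith) 2)]
      linarith
    · have hcq : c = q * (2 + k) := by rw [hc, hk]; field_simp; ring
      have : c * t / (1 + k * t + t ^ 2) < q := by
        rw [div_lt_iff₀ hd, hcq]
        nlinarith [mul_pos hq (pow_pos (show 0 < 1 - t by linarith) 2)]
      linarith
  · exact Or.inl (Or.inl (hup h))

/-- First and second derivatives at the origin of `f ∘ slitMap x c k`. -/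
lemma deriv_comp_slitMap {f : ℂ → ℂ} {x c k : ℝ} (hf : AnalyticAt ℂ f x) :
    deriv (f ∘ slitMap x c k) 0 = c * deriv f x ∧
    deriv (deriv (f ∘ slitMap x c k)) 0 =
      c ^ 2 * deriv (deriv f) x - 2 * k * c * deriv f x := by
  have hx0 : slitMap x c k 0 = x := by simp [slitMap]
  have hden : ∀ᶠ w : ℂ in nhds 0, 1 + k * w + w ^ 2 ≠ 0 := by
    have : ContinuousAt (fun w : ℂ => 1 + k * w + w ^ 2) 0 := by fun_prop
    exact this.eventually_ne (by simp)
  have hψ0 := hasDerivAt_slitMap x c (k := k) (w := 0) (by simp)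
  have hev : ∀ᶠ w in nhds (0 : ℂ), AnalyticAt ℂ f (slitMap x c k w) := by
    have := hf.eventually_analyticAt
    rw [← hx0] at this
    exact hψ0.continuousAt.eventually this
  have hderiv : deriv (f ∘ slitMap x c k) =ᶠ[nhds 0] fun w =>
      deriv f (slitMap x c k w) * (c * (1 - w ^ 2) / (1 + k * w + w ^ 2) ^ 2) := by
    filter_upwards [hden, hev] with w h1 h2
    exact (h2.differentiableAt.hasDerivAt.comp w (hasDerivAt_slitMap x c h1)).deriv
  refine ⟨?_, ?_⟩
  · rw [hderiv.self_of_nhds]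
    simp [hx0, mul_comm]
  · rw [hderiv.deriv_eq]
    have h1 : HasDerivAt (fun w => deriv f (slitMap x c k w)) (deriv (deriv f) x * c) 0 := by
      have hd : HasDerivAt (deriv f) (deriv (deriv f) x) (slitMap x c k 0) := by
        rw [hx0]; exact hf.deriv.differentiableAt.hasDerivAt
      simpa [Function.comp_def] using hd.comp (0 : ℂ) hψ0
    have h2 : HasDerivAt (fun w : ℂ => (c : ℂ) * (1 - w ^ 2) / (1 + k * w + w ^ 2) ^ 2)
        (-2 * k * c : ℂ) 0 := by
      have hnum : HasDerivAt (fun w : ℂ => (c : ℂ) * (1 - w ^ 2)) 0 0 := by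
        simpa using ((hasDerivAt_pow 2 (0 : ℂ)).const_sub 1).const_mul (c : ℂ)
      have hd1 : HasDerivAt (fun w : ℂ => 1 + k * w + w ^ 2) (k : ℂ) 0 := by
        simpa using (((hasDerivAt_id (0 : ℂ)).const_mul (k : ℂ)).const_add 1).fun_add
          (hasDerivAt_pow 2 (0 : ℂ))
      refine (hnum.fun_div (hd1.fun_pow 2) (by simp)).congr_deriv ?_
      simp
      ring
    rw [(h1.fun_mul h2).deriv, hx0]
    simp
    ring

/-- A non-constant Herglotz function on `Omega a b` has strictly positive (real)
derivative on `(a,b)`, and `-2/(z-a) ≤ f''/f' ≤ 2/(b-z)` there. -/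
theorem herglotz_deriv_bounds (a b : ℝ) (hab : a < b) (f : ℂ → ℂ)
    (hf : Herglotzian a b f)
    (hnc : ∃ z ∈ Omega a b, ∃ w ∈ Omega a b, f z ≠ f w) :
    (∀ x ∈ Set.Ioo a b, (deriv f (x:ℂ)).im = 0 ∧ 0 < (deriv f (x:ℂ)).re) ∧
    ∀ z ∈ Set.Ioo a b,
      -2 / (z - a) ≤ (deriv (deriv f) (z:ℂ)).re / (deriv f (z:ℂ)).re ∧
      (deriv (deriv f) (z:ℂ)).re / (deriv f (z:ℂ)).re ≤ 2 / (b - z) := by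
  have hΩ := isOpen_Omega_s5 a b
  have main : ∀ x ∈ Ioo a b, 0 < (deriv f (x : ℂ)).re ∧
      -2 / (x - a) ≤ (deriv (deriv f) (x : ℂ)).re / (deriv f (x : ℂ)).re ∧
      (deriv (deriv f) (x : ℂ)).re / (deriv f (x : ℂ)).re ≤ 2 / (b - x) := by
    intro x hx
    obtain ⟨p, rfl⟩ : ∃ p, a = x - p := ⟨x - a, by ring⟩
    obtain ⟨q, rfl⟩ : ∃ q, b = x + q := ⟨b - x, by ring⟩
    have hp : 0 < p := by linarith [hx.1]
    have hq : 0 < q := by linarith [hx.2]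
    have hmem := fun w hw => slitMap_mem_Omega (x := x) hp hq (w := w) hw
    have hcp : 4 * p * q / (p + q) = p * (2 - 2 * (p - q) / (p + q)) := by field_simp; ring
    have hcq : 4 * p * q / (p + q) = q * (2 + 2 * (p - q) / (p + q)) := by field_simp; ring
    have hc : 0 < 4 * p * q / (p + q) := by positivity
    have hk2 : |2 * (p - q) / (p + q)| < 2 := by
      rw [abs_lt]
      constructor
      · rw [lt_div_iff₀ (by positivity)]; linarith
      · rw [div_lt_iff₀ (by positivity)]; linarith
    generalize 4 * p * q / (p + q) = c at *
    generalize 2 * (p - q) / (p + q) = k at *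
    have han : AnalyticAt ℂ f x := hf.1.analyticAt (hΩ.mem_nhds (Or.inr ⟨x, hx, rfl⟩))
    obtain ⟨hd1, hd2⟩ := deriv_comp_slitMap (c := c) (k := k) han
    have hbound := typicallyReal_second_deriv_bound (g := f ∘ slitMap x c k)
      (hf.1.comp (fun w hw => (hasDerivAt_slitMap x c
        (slitMap_denom_ne_zero hk2 hw)).differentiableAt.differentiableWithinAt)
        fun w hw => (hmem w hw).1)
      (fun w hw h => hf.im_pos hab hnc ((hmem w hw).2.1 h))
      (fun w hw h => by
        have hlow := (hmem w hw).2.2 h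
        have hpos := hf.im_pos hab hnc (z := starRingEnd ℂ (slitMap x c k w)) (by simpa using hlow)
        rw [hf.2.1 _ (hmem w hw).1] at hpos
        simp only [Complex.conj_im] at hpos
        simp only [Function.comp_apply]
        linarith)
    have hr1 : (deriv (f ∘ slitMap x c k) 0).re = c * (deriv f x).re := by
      rw [hd1, Complex.re_ofReal_mul]
    have hr2 : (deriv (deriv (f ∘ slitMap x c k)) 0).re =
        c ^ 2 * (deriv (deriv f) x).re - 2 * k * c * (deriv f x).re := by
      rw [hd2, show (c : ℂ) ^ 2 * deriv (deriv f) x - 2 * k * c * deriv f x =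
        ((c ^ 2 : ℝ) : ℂ) * deriv (deriv f) x - ((2 * k * c : ℝ) : ℂ) * deriv f x by push_cast; ring,
        Complex.sub_re, Complex.re_ofReal_mul, Complex.re_ofReal_mul]
    rw [hr1, hr2] at hbound
    generalize (deriv f x).re = A at *
    generalize (deriv (deriv f) x).re = B at *
    have hA : 0 < A := pos_of_mul_pos_right hbound.1 hc.le
    obtain ⟨hl, hu⟩ := abs_le.mp hbound.2
    have hl' : -2 * (2 - k) * A ≤ c * B := le_of_mul_le_mul_left (by linarith) hc
    have hu' : c * B ≤ 2 * (2 + k) * A := le_of_mul_le_mul_left (by linarith) hc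
    obtain ⟨hk3, hk4⟩ := abs_lt.mp hk2
    refine ⟨hA, ?_, ?_⟩
    · rw [show x - (x - p) = p by ring, div_le_div_iff₀ hp hA]
      rw [hcp] at hl'
      exact le_of_mul_le_mul_left (by linarith) (show 0 < 2 - k by linarith)
    · rw [show x + q - x = q by ring, div_le_div_iff₀ hA hq]
      rw [hcq] at hu'
      exact le_of_mul_le_mul_left (by linarith) (show 0 < 2 + k by linarith)
  exact ⟨fun x hx => ⟨hf.im_deriv_eq_zero hx, (main x hx).1⟩, fun x hx => (main x hx).2⟩
end
end

section
/- Let u₋, u₊ ∈ (0,1) and let σ : ℝ → [0,1] be a measurable function vanishing on (−1/u₋, 1) and equal to 1 on [1, 1/u₊], and define ψ on (−1/u₋, 1) by log ψ(z) = ∫_{ℝ ∖ (−1/u₋, 1)} σ(t)·[1/t − 1/(t−z)] dt. Then: (i) for all z ∈ (0, 1), ψ(z)(1 − u₊z)/(1 − z) ≤ 1 ≤ ψ(z)(1 + u₋z)/(1 − z), and for all z ∈ (−1/u₋, 0) the reversed inequalities hold; (ii) for all z ∈ (−1/u₋, 1), (1 − u₊)/((1 − z)(1 − u₊z)) ≤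 −ψ′(z)/ψ(z) ≤ (1 + u₋)/((1 − z)(1 + u₋z)). -/
open MeasureTheory Set Real Filter

noncomputable section

lemma hasDerivAt_neg_inv_sub {t z : ℝ} (h : t ≠ z) :
    HasDerivAt (fun t : ℝ => -(t - z)⁻¹) (((t - z) ^ 2)⁻¹) t := by
  refine (((hasDerivAt_id t).sub_const z).inv (sub_ne_zero.2 h)).neg.congr_deriv ?_
  simp [div_eq_mul_inv]

lemma hasDerivAt_kernel {t z : ℝ} (h : t ≠ z) (s : ℝ) :
    HasDerivAt (fun z : ℝ => s * (1 / t - 1 / (t - z))) (-(s * ((t - z) ^ 2)⁻¹)) z := by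
  have h1 := ((((hasDerivAt_id z).const_sub t).inv (sub_ne_zero.2 h)).const_sub (1 / t)).const_mul s
  simp only [one_div] at h1 ⊢
  refine h1.congr_deriv ?_
  simp [div_eq_mul_inv]

lemma integrableOn_integral_inv_sq_Ioi {c z : ℝ} (h : z < c) :
    IntegrableOn (fun t : ℝ => ((t - z) ^ 2)⁻¹) (Ioi c) ∧
      ∫ t in Ioi c, ((t - z) ^ 2)⁻¹ = (c - z)⁻¹ := by
  have hd : ∀ x ∈ Ici c, HasDerivAt (fun t : ℝ => -(t - z)⁻¹) (((x - z) ^ 2)⁻¹) x :=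
    fun x hx => hasDerivAt_neg_inv_sub (h.trans_le hx).ne'
  have hp : ∀ x ∈ Ioi c, 0 ≤ ((x - z) ^ 2)⁻¹ := fun x _ => by positivity
  have hl : Tendsto (fun t : ℝ => -(t - z)⁻¹) atTop (nhds 0) := by
    simpa [sub_eq_add_neg] using (tendsto_inv_atTop_zero.comp (tendsto_atTop_add_const_right atTop (-z) tendsto_id)).neg
  refine ⟨integrableOn_Ioi_deriv_of_nonneg' hd hp hl, ?_⟩
  rw [integral_Ioi_of_hasDerivAt_of_nonneg' hd hp hl]
  ring

lemma integrableOn_integral_inv_sq_Iic {c z : ℝ} (h : c < z) :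
    IntegrableOn (fun t : ℝ => ((t - z) ^ 2)⁻¹) (Iic c) ∧
      ∫ t in Iic c, ((t - z) ^ 2)⁻¹ = (z - c)⁻¹ := by
  have heq : (fun t : ℝ => ((t - z) ^ 2)⁻¹) = fun t => (fun t : ℝ => ((t - -z) ^ 2)⁻¹) (-t) := by
    funext t
    ring_nf
  obtain ⟨hi, hv⟩ := integrableOn_integral_inv_sq_Ioi (neg_lt_neg h)
  constructor
  · have h1 := ((Measure.measurePreserving_neg (volume : Measure ℝ)).integrableOn_comp_preimage
      (Homeomorph.neg ℝ).measurableEmbedding (f := fun t : ℝ => ((t - -z) ^ 2)⁻¹)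
      (s := Ici (-c))).2 ((integrableOn_Ici_iff_integrableOn_Ioi (by simp)).2 hi)
    have hs : (Neg.neg ⁻¹' Ici (-c) : Set ℝ) = Iic c := by
      ext t
      simp
    rw [hs] at h1
    rw [heq]
    exact h1
  · rw [heq, integral_comp_neg_Iic c fun t : ℝ => ((t - -z) ^ 2)⁻¹, hv]
    ring_nf

lemma integral_inv_sq_Icc {a b z : ℝ} (hza : z < a) (hab : a ≤ b) :
    ∫ t in Icc a b, ((t - z) ^ 2)⁻¹ = (a - z)⁻¹ - (b - z)⁻¹ := by
  rw [integral_Icc_eq_integral_Ioc, ← intervalIntegral.integral_of_le hab,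
    intervalIntegral.integral_eq_sub_of_hasDerivAt (f := fun t : ℝ => -(t - z)⁻¹)]
  · ring
  · intro x hx
    rw [uIcc_of_le hab] at hx
    exact hasDerivAt_neg_inv_sub (hza.trans_le hx.1).ne'
  · apply ContinuousOn.intervalIntegrable
    intro x hx
    rw [uIcc_of_le hab] at hx
    have : x - z ≠ 0 := (sub_pos.2 (hza.trans_le hx.1)).ne'
    exact ContinuousAt.continuousWithinAt (by fun_prop (disch := positivity))

lemma compl_Ioo_eq_union (a b : ℝ) : (Ioo a b)ᶜ = Iic a ∪ Ici b := by
  ext t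
  simp only [mem_compl_iff, mem_Ioo, mem_union, mem_Iic, mem_Ici]
  grind

lemma integrableOn_integral_inv_sq_compl_Ioo {a b z : ℝ} (hz : z ∈ Ioo a b) :
    IntegrableOn (fun t : ℝ => ((t - z) ^ 2)⁻¹) (Ioo a b)ᶜ ∧
      ∫ t in (Ioo a b)ᶜ, ((t - z) ^ 2)⁻¹ = (z - a)⁻¹ + (b - z)⁻¹ := by
  obtain ⟨hi, hv⟩ := integrableOn_integral_inv_sq_Iic hz.1
  obtain ⟨hi', hv'⟩ := integrableOn_integral_inv_sq_Ioi hz.2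
  have hi'' := (integrableOn_Ici_iff_integrableOn_Ioi (by simp)).2 hi'
  rw [compl_Ioo_eq_union]
  refine ⟨hi.union hi'', ?_⟩
  rw [setIntegral_union _ measurableSet_Ici hi hi'', hv, integral_Ici_eq_integral_Ioi, hv']
  exact Set.disjoint_left.2 fun t h1 h2 => absurd (hz.1.trans hz.2) (not_lt.2 (le_trans h2 h1))

/-- Away from the gap `(a, b)`, the Herglotz-type integral can be differentiated under the
integral sign. -/
lemma hasDerivAt_integral_kernel {a b z : ℝ} (hz : z ∈ Ioo a b) {σ : ℝ → ℝ}
    (hσm : Measurable σ) (hσ01 : ∀ t, σ t ∈ Icc (0 : ℝ) 1)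
    (hint : IntegrableOn (fun t => σ t * (1 / t - 1 / (t - z))) (Ioo a b)ᶜ) :
    IntegrableOn (fun t => σ t * ((t - z) ^ 2)⁻¹) (Ioo a b)ᶜ ∧
      HasDerivAt (fun z => ∫ t in (Ioo a b)ᶜ, σ t * (1 / t - 1 / (t - z)))
        (-∫ t in (Ioo a b)ᶜ, σ t * ((t - z) ^ 2)⁻¹) z := by
  obtain ⟨haz, hzb⟩ := hz
  set s : Set ℝ := Ioo ((a + z) / 2) ((z + b) / 2) with hs
  have hmem : ∀ᵐ t ∂(volume.restrict (Ioo a b)ᶜ), t ≤ a ∨ b ≤ t := by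
    refine (ae_restrict_mem measurableSet_Ioo.compl).mono fun t ht => ?_
    rwa [compl_Ioo_eq_union] at ht
  have key := hasDerivAt_integral_of_dominated_loc_of_deriv_le
    (μ := volume.restrict (Ioo a b)ᶜ) (F := fun z t => σ t * (1 / t - 1 / (t - z)))
    (F' := fun z t => -(σ t * ((t - z) ^ 2)⁻¹)) (x₀ := z) (s := s)
    (bound := fun t => 4 * ((t - z) ^ 2)⁻¹)
    (Ioo_mem_nhds (by linarith) (by linarith))
    (Eventually.of_forall fun x => Measurable.aestronglyMeasurable (by fun_prop))
    hint (Measurable.aestronglyMeasurable (by fun_prop))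
    (hmem.mono fun t ht x hx => ?_)
    ((integrableOn_integral_inv_sq_compl_Ioo ⟨haz, hzb⟩).1.const_mul 4)
    (hmem.mono fun t ht x hx => hasDerivAt_kernel ?_ _)
  · refine ⟨by simpa [IntegrableOn] using key.1.neg, ?_⟩
    rw [← integral_neg]
    exact key.2
  · obtain ⟨h0, h1⟩ := hσ01 t
    rw [norm_neg, Real.norm_of_nonneg (by positivity)]
    have hxz : (t - z) ^ 2 ≤ 4 * (t - x) ^ 2 := by
      rcases ht with ht | ht <;> nlinarith [hx.1, hx.2]
    have hpos : 0 < (t - z) ^ 2 := by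
      have : t - z ≠ 0 := by rcases ht with ht | ht <;> intro h <;> linarith
      positivity
    calc σ t * ((t - x) ^ 2)⁻¹ ≤ 1 * ((t - x) ^ 2)⁻¹ := by gcongr
      _ = 4 * (4 * (t - x) ^ 2)⁻¹ := by rw [mul_inv]; ring
      _ ≤ 4 * ((t - z) ^ 2)⁻¹ := by gcongr
  · rcases ht with ht | ht
    · exact (show t < x by linarith [hx.1]).ne
    · exact (show x < t by linarith [hx.2]).ne'

/-- The derivative of `log (e^f (1 + c z) / (1 - z))`. -/
lemma hasDerivAt_add_log_sub_log {c z l : ℝ} {f : ℝ → ℝ} (h1 : 0 < 1 + c * z) (hz : z < 1)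
    (hf : HasDerivAt f (-l) z) :
    HasDerivAt (fun z => f z + log (1 + c * z) - log (1 - z))
      ((1 + c) / ((1 - z) * (1 + c * z)) - l) z := by
  have h2 : 0 < 1 - z := sub_pos.2 hz
  have hl1 := (((hasDerivAt_id z).const_mul c).const_add 1).log h1.ne'
  have hl2 := ((hasDerivAt_id z).const_sub 1).log h2.ne'
  refine ((hf.add hl1).sub hl2).congr_deriv ?_
  simp only [id]
  field_simp
  ring

/-- If the derivative `-L` of `f` is at most the logarithmic derivative of `(1 - z) / (1 + c z)` on `(a, 1)`, then
`f z - log ((1 - z) / (1 + c z))` is antitone there. -/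
lemma antitoneOn_log_add_log_sub_log {a c : ℝ} {f L : ℝ → ℝ}
    (hc : ∀ z ∈ Ioo a 1, 0 < 1 + c * z) (hf : ∀ z ∈ Ioo a 1, HasDerivAt f (-L z) z)
    (hL : ∀ z ∈ Ioo a 1, (1 + c) / ((1 - z) * (1 + c * z)) ≤ L z) :
    AntitoneOn (fun z => f z + log (1 + c * z) - log (1 - z)) (Ioo a 1) := by
  have hd : ∀ z ∈ Ioo a 1, HasDerivAt (fun z => f z + log (1 + c * z) - log (1 - z))
      ((1 + c) / ((1 - z) * (1 + c * z)) - L z) z :=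
    fun z hz => hasDerivAt_add_log_sub_log (hc z hz) hz.2 (hf z hz)
  apply antitoneOn_of_deriv_nonpos (convex_Ioo a 1)
  · exact fun z hz => (hd z hz).continuousAt.continuousWithinAt
  · rw [interior_Ioo]
    exact fun z hz => (hd z hz).differentiableAt.differentiableWithinAt
  · rw [interior_Ioo]
    intro z hz
    rw [(hd z hz).deriv]
    linarith [hL z hz]

/-- The reversed version of `antitoneOn_log_add_log_sub_log`. -/
lemma monotoneOn_log_add_log_sub_log {a c : ℝ} {f L : ℝ → ℝ}
    (hc : ∀ z ∈ Ioo a 1, 0 < 1 + c * z) (hf : ∀ z ∈ Ioo a 1, HasDerivAt f (-L z) z)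
    (hL : ∀ z ∈ Ioo a 1, L z ≤ (1 + c) / ((1 - z) * (1 + c * z))) :
    MonotoneOn (fun z => f z + log (1 + c * z) - log (1 - z)) (Ioo a 1) := by
  have hd : ∀ z ∈ Ioo a 1, HasDerivAt (fun z => f z + log (1 + c * z) - log (1 - z))
      ((1 + c) / ((1 - z) * (1 + c * z)) - L z) z :=
    fun z hz => hasDerivAt_add_log_sub_log (hc z hz) hz.2 (hf z hz)
  apply monotoneOn_of_deriv_nonneg (convex_Ioo a 1)
  · exact fun z hz => (hd z hz).continuousAt.continuousWithinAt
  · rw [interior_Ioo]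
    exact fun z hz => (hd z hz).differentiableAt.differentiableWithinAt
  · rw [interior_Ioo]
    intro z hz
    rw [(hd z hz).deriv]
    linarith [hL z hz]

/-- Inequalities (2.5) and (2.6) for a function `ψ` in the class `E₀(um, up)`,
given by the Herglotz-type integral representation. -/
theorem E0_inequalities (um up : ℝ)
    (hum : um ∈ Set.Ioo (0:ℝ) 1) (hup : up ∈ Set.Ioo (0:ℝ) 1)
    (σ : ℝ → ℝ) (hσm : Measurable σ) (hσ01 : ∀ t, σ t ∈ Set.Icc (0:ℝ) 1)
    (hσ0 : ∀ t ∈ Set.Ioo (-1/um) (1:ℝ), σ t = 0)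
    (hσ1 : ∀ t ∈ Set.Icc (1:ℝ) (1/up), σ t = 1)
    (ψ : ℝ → ℝ)
    (hψpos : ∀ z ∈ Set.Ioo (-1/um) (1:ℝ), 0 < ψ z)
    (hint : ∀ z ∈ Set.Ioo (-1/um) (1:ℝ),
      IntegrableOn (fun t => σ t * (1/t - 1/(t - z))) (Set.Ioo (-1/um) (1:ℝ))ᶜ)
    (hψ : ∀ z ∈ Set.Ioo (-1/um) (1:ℝ),
      Real.log (ψ z) = ∫ t in (Set.Ioo (-1/um) (1:ℝ))ᶜ, σ t * (1/t - 1/(t - z))) :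
    (∀ z ∈ Set.Ioo (0:ℝ) 1,
      ψ z * (1 - up * z) / (1 - z) ≤ 1 ∧ 1 ≤ ψ z * (1 + um * z) / (1 - z)) ∧
    (∀ z ∈ Set.Ioo (-1/um) (0:ℝ),
      1 ≤ ψ z * (1 - up * z) / (1 - z) ∧ ψ z * (1 + um * z) / (1 - z) ≤ 1) ∧
    (∀ z ∈ Set.Ioo (-1/um) (1:ℝ),
      (1 - up) / ((1 - z) * (1 - up * z)) ≤ -(deriv ψ z) / ψ z ∧
      -(deriv ψ z) / ψ z ≤ (1 + um) / ((1 - z) * (1 + um * z))) := by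
  obtain ⟨hum0, hum1⟩ := hum
  obtain ⟨hup0, hup1⟩ := hup
  have ha : -1 / um < 0 := div_neg_of_neg_of_pos (by norm_num) hum0
  have h0 : (0 : ℝ) ∈ Ioo (-1 / um) 1 := ⟨ha, one_pos⟩
  have hB : 1 < 1 / up := (one_lt_div hup0).2 hup1
  have hposm : ∀ z ∈ Ioo (-1 / um) (1 : ℝ), 0 < 1 + um * z := fun z hz => by
    have := (div_lt_iff₀ hum0).1 hz.1
    linarith
  have hposp : ∀ z ∈ Ioo (-1 / um) (1 : ℝ), 0 < 1 + -up * z := fun z hz => by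
    nlinarith [hz.2]
  set S : Set ℝ := (Ioo (-1 / um) (1 : ℝ))ᶜ
  set L : ℝ → ℝ := fun z => ∫ t in S, σ t * ((t - z) ^ 2)⁻¹
  have hkey := fun z (hz : z ∈ Ioo (-1 / um) (1 : ℝ)) =>
    hasDerivAt_integral_kernel hz hσm hσ01 (hint z hz)
  have hlog : ∀ z ∈ Ioo (-1 / um) (1 : ℝ), HasDerivAt (fun z => log (ψ z)) (-L z) z :=
    fun z hz => (hkey z hz).2.congr_of_eventuallyEq
      (eventually_of_mem (Ioo_mem_nhds hz.1 hz.2) fun x hx => hψ x hx)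
  have hdψ : ∀ z ∈ Ioo (-1 / um) (1 : ℝ), -(deriv ψ z) / ψ z = L z := by
    intro z hz
    have h1 : HasDerivAt ψ (Real.exp (log (ψ z)) * -L z) z :=
      (hlog z hz).exp.congr_of_eventuallyEq
        (eventually_of_mem (Ioo_mem_nhds hz.1 hz.2) fun x hx => (Real.exp_log (hψpos x hx)).symm)
    rw [h1.deriv, Real.exp_log (hψpos z hz)]
    field_simp [(hψpos z hz).ne']
  have hlow : ∀ z ∈ Ioo (-1 / um) (1 : ℝ), (1 + -up) / ((1 - z) * (1 + -up * z)) ≤ L z := by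
    intro z hz
    have h1 : 0 < 1 - z := sub_pos.2 hz.2
    have h2 := hposp z hz
    have hsub : Icc 1 (1 / up) ⊆ S := fun t ht h => absurd ht.1 (not_le.2 h.2)
    calc (1 + -up) / ((1 - z) * (1 + -up * z)) = (1 - z)⁻¹ - (1 / up - z)⁻¹ := by
          have h3 : 1 / up - z = (1 + -up * z) / up := by field_simp; ring
          rw [h3, inv_div, inv_eq_one_div, div_sub_div _ _ h1.ne' h2.ne']
          congr 1
          ring
      _ = ∫ t in Icc 1 (1 / up), ((t - z) ^ 2)⁻¹ := (integral_inv_sq_Icc hz.2 hB.le).symm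
      _ = ∫ t in Icc 1 (1 / up), σ t * ((t - z) ^ 2)⁻¹ :=
          setIntegral_congr_fun measurableSet_Icc fun t ht => by simp [hσ1 t ht]
      _ ≤ L z := setIntegral_mono_set (hkey z hz).1
          (Eventually.of_forall fun t => mul_nonneg (hσ01 t).1 (by positivity))
          hsub.eventuallyLE
  have hupp : ∀ z ∈ Ioo (-1 / um) (1 : ℝ), L z ≤ (1 + um) / ((1 - z) * (1 + um * z)) := by
    intro z hz
    have h1 : 0 < 1 - z := sub_pos.2 hz.2
    have h2 := hposm z hz
    obtain ⟨hi, hv⟩ := integrableOn_integral_inv_sq_compl_Ioo hz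
    calc L z ≤ ∫ t in S, ((t - z) ^ 2)⁻¹ := integral_mono (hkey z hz).1 hi fun t =>
          mul_le_of_le_one_left (by positivity) (hσ01 t).2
      _ = (1 + um) / ((1 - z) * (1 + um * z)) := by
          have h3 : z - -1 / um = (1 + um * z) / um := by field_simp; ring
          rw [hv, h3]
          field_simp
          ring
  have hψ0 : log (ψ 0) = 0 := by simp [hψ 0 h0]
  have hanti := antitoneOn_log_add_log_sub_log hposp hlog hlow
  have hmono := monotoneOn_log_add_log_sub_log hposm hlog hupp
  have hquot : ∀ c z : ℝ, z ∈ Ioo (-1 / um) (1 : ℝ) → 0 < 1 + c * z →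
      0 < ψ z * (1 + c * z) / (1 - z) ∧ log (ψ z * (1 + c * z) / (1 - z)) =
        log (ψ z) + log (1 + c * z) - log (1 - z) := by
    intro c z hz h2
    have h1 : 0 < 1 - z := sub_pos.2 hz.2
    have h3 := hψpos z hz
    exact ⟨by positivity, by rw [log_div (by positivity) h1.ne', log_mul h3.ne' h2.ne']⟩
  simp only [sub_eq_add_neg (1 : ℝ) (up * _), ← neg_mul, sub_eq_add_neg (1 : ℝ) up]
  refine ⟨fun z hz => ?_, fun z hz => ?_, fun z hz => ?_⟩
  · have hz' : z ∈ Ioo (-1 / um) (1 : ℝ) := ⟨ha.trans hz.1, hz.2⟩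
    obtain ⟨hp, hp'⟩ := hquot (-up) z hz' (hposp z hz')
    obtain ⟨hm, hm'⟩ := hquot um z hz' (hposm z hz')
    have h1 := hanti h0 hz' hz.1.le
    have h2 := hmono h0 hz' hz.1.le
    simp only [hψ0, mul_zero, add_zero, sub_zero, log_one] at h1 h2
    exact ⟨(log_nonpos_iff hp.le).1 (hp'.trans_le h1), (log_nonneg_iff hm).1 (h2.trans_eq hm'.symm)⟩
  · have hz' : z ∈ Ioo (-1 / um) (1 : ℝ) := ⟨hz.1, hz.2.trans one_pos⟩
    obtain ⟨hp, hp'⟩ := hquot (-up) z hz' (hposp z hz')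
    obtain ⟨hm, hm'⟩ := hquot um z hz' (hposm z hz')
    have h1 := hanti hz' h0 hz.2.le
    have h2 := hmono hz' h0 hz.2.le
    simp only [hψ0, mul_zero, add_zero, sub_zero, log_one] at h1 h2
    exact ⟨(log_nonneg_iff hp).1 (h1.trans_eq hp'.symm), (log_nonpos_iff hm.le).1 (hm'.trans_le h2)⟩
  · rw [hdψ z hz]
    exact ⟨hlow z hz, hupp z hz⟩
end
end

section
/- Let u₋ ∈ (0,1), let σ : ℝ → [0,1] be a measurable function vanishing on (−1/u₋, 1), let M > 0 satisfy ∫_{ℝ ∖ (−1/u₋, 1)} σ(t)/(t(1 + u₋t)) dt ≤ log M, and define ψ on (−1/u₋, 1) by log ψ(z) = ∫_{ℝ ∖ (−1/u₋, 1)} σ(t)·[1/t − 1/(t−z)] dt. Then for all z with −1/u₋ < z < 0, −ψ′(z)/ψ(z) ≤ log M / ((−4z)(1 + u₋z)). -/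
open MeasureTheory Set Real Filter

noncomputable section

/-- The arithmetic-geometric mean inequality for `t(1+uz)` and `-z(1+ut)`, whose sum is `t-z`. -/
lemma four_mul_mul_le_sq_sub (u t z : ℝ) :
    (t * (1 + u * t)) * ((-4 * z) * (1 + u * z)) ≤ (t - z) ^ 2 := by
  nlinarith [sq_nonneg (t * (1 + u * z) + z * (1 + u * t))]

lemma mul_one_add_pos_of_notMem_Ioo {u t : ℝ} (hu : 0 < u) (ht : t ∉ Set.Ioo (-1/u) (1:ℝ))
    (hne : t ≠ -1/u) : 0 < t * (1 + u * t) := by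
  rcases lt_or_ge (-1/u) t with h | h
  · have h1 : 1 ≤ t := not_lt.mp fun h' => ht ⟨h, h'⟩
    positivity
  · have h1 : t < -1/u := lt_of_le_of_ne h hne
    have h2 : t * u < -1 := (lt_div_iff₀ hu).mp h1
    have h3 : t < 0 := h1.trans (div_neg_of_neg_of_pos (by norm_num) hu)
    nlinarith

lemma div_sq_sub_le {u s t z c : ℝ} (hs : 0 ≤ s) (ht : 0 < t * (1 + u * t)) (hc : 0 < c)
    (hcz : c ≤ (-4 * z) * (1 + u * z)) :
    s / (t - z) ^ 2 ≤ s / (t * (1 + u * t)) / c := by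
  rw [div_div]
  exact div_le_div_of_nonneg_left hs (mul_pos ht hc)
    ((mul_le_mul_of_nonneg_left hcz ht.le).trans (four_mul_mul_le_sq_sub u t z))

/-- Inequality (2.7): if the representing measure has total mass at most `log M`
against `1/(t(1+umt))`, then `-ψ'(z)/ψ(z) ≤ log M / ((-4z)(1+umz))` for `z < 0`. -/
theorem E0_logderiv_bound (um M : ℝ) (hum : um ∈ Set.Ioo (0:ℝ) 1) (hM : 0 < M)
    (σ : ℝ → ℝ) (hσm : Measurable σ) (hσ01 : ∀ t, σ t ∈ Set.Icc (0:ℝ) 1)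
    (hσ0 : ∀ t ∈ Set.Ioo (-1/um) (1:ℝ), σ t = 0)
    (hMint : IntegrableOn (fun t => σ t / (t * (1 + um * t))) (Set.Ioo (-1/um) (1:ℝ))ᶜ)
    (hMbd : ∫ t in (Set.Ioo (-1/um) (1:ℝ))ᶜ, σ t / (t * (1 + um * t)) ≤ Real.log M)
    (ψ : ℝ → ℝ)
    (hψpos : ∀ z ∈ Set.Ioo (-1/um) (1:ℝ), 0 < ψ z)
    (hint : ∀ z ∈ Set.Ioo (-1/um) (1:ℝ),
      IntegrableOn (fun t => σ t * (1/t - 1/(t - z))) (Set.Ioo (-1/um) (1:ℝ))ᶜ)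
    (hψ : ∀ z ∈ Set.Ioo (-1/um) (1:ℝ),
      Real.log (ψ z) = ∫ t in (Set.Ioo (-1/um) (1:ℝ))ᶜ, σ t * (1/t - 1/(t - z))) :
    ∀ z ∈ Set.Ioo (-1/um) (0:ℝ),
      -(deriv ψ z) / ψ z ≤ Real.log M / ((-4 * z) * (1 + um * z)) := by
  intro z hz
  obtain ⟨hu, -⟩ := hum
  obtain ⟨hz1, hz0⟩ := hz
  have hzI : z ∈ Set.Ioo (-1/um) (1:ℝ) := ⟨hz1, hz0.trans one_pos⟩
  set μ := volume.restrict (Set.Ioo (-1/um) (1:ℝ))ᶜ with hμ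
  have hae : ∀ᵐ t ∂μ, t ∉ Set.Ioo (-1/um) (1:ℝ) ∧ 0 < t * (1 + um * t) := by
    filter_upwards [ae_restrict_mem measurableSet_Ioo.compl,
      ae_restrict_of_ae (Measure.ae_ne volume (-1/um))] with t ht hne
    exact ⟨ht, mul_one_add_pos_of_notMem_Ioo hu ht hne⟩
  have one_add_pos : ∀ x, -1/um < x → 0 < 1 + um * x := fun x hx => by
    have := (div_lt_iff₀ hu).mp hx
    linarith
  obtain ⟨a, ha1, haz⟩ := exists_between hz1
  obtain ⟨b, hzb, hb0⟩ := exists_between hz0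
  have hsub : Set.Ioo a b ⊆ Set.Ioo (-1/um) (1:ℝ) := fun x hx =>
    ⟨ha1.trans hx.1, hx.2.trans (hb0.trans one_pos)⟩
  have hs : Set.Ioo a b ∈ nhds z := Ioo_mem_nhds haz hzb
  have ha := one_add_pos a ha1
  have hc : 0 < (-4 * b) * (1 + um * a) := mul_pos (by linarith) ha
  obtain ⟨hF'int, hderiv⟩ := hasDerivAt_integral_of_dominated_loc_of_deriv_le
    (μ := μ) (F := fun x t => σ t * (1/t - 1/(t - x))) (F' := fun x t => -(σ t / (t - x) ^ 2))
    (bound := fun t => σ t / (t * (1 + um * t)) / ((-4 * b) * (1 + um * a)))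
    hs (Eventually.of_forall fun x => by fun_prop) (hint z hzI)
    (hσm.div ((measurable_id.sub_const z).pow_const 2)).neg.aestronglyMeasurable
    (by
      filter_upwards [hae] with t ht x hx
      rw [norm_neg, Real.norm_of_nonneg (div_nonneg (hσ01 t).1 (sq_nonneg _))]
      refine div_sq_sub_le (hσ01 t).1 ht.2 hc ?_
      have : um * a ≤ um * x := mul_le_mul_of_nonneg_left hx.1.le hu.le
      exact mul_le_mul (by linarith [hx.2]) (by linarith) ha.le (by linarith [hx.2]))
    (hMint.div_const _)
    (by
      filter_upwards [hae] with t ht x hx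
      have hne : t - x ≠ 0 := sub_ne_zero.mpr fun h => ht.1 (h ▸ hsub hx)
      have h := (((hasDerivAt_id x).const_sub t).fun_inv hne).const_sub (1/t) |>.const_mul (σ t)
      simp only [id, ← one_div] at h
      exact h.congr_deriv (by ring))
  have hψd : HasDerivAt ψ (ψ z * ∫ t, -(σ t / (t - z) ^ 2) ∂μ) z := by
    have h := hderiv.exp
    rw [← hψ z hzI, Real.exp_log (hψpos z hzI)] at h
    refine h.congr_of_eventuallyEq ?_
    filter_upwards [hs] with x hx
    rw [← hψ x (hsub hx), Real.exp_log (hψpos x (hsub hx))]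
  have hcz : 0 < (-4 * z) * (1 + um * z) := mul_pos (by linarith) (one_add_pos z hz1)
  have hψz := (hψpos z hzI).ne'
  calc -(deriv ψ z) / ψ z = ∫ t, σ t / (t - z) ^ 2 ∂μ := by
        rw [hψd.deriv, integral_neg]
        field_simp
    _ ≤ ∫ t, σ t / (t * (1 + um * t)) / ((-4 * z) * (1 + um * z)) ∂μ := by
        refine integral_mono_ae (by simpa using hF'int.neg) (hMint.div_const _) ?_
        filter_upwards [hae] with t ht
        exact div_sq_sub_le (hσ01 t).1 ht.2 hcz le_rfl
    _ ≤ Real.log M / ((-4 * z) * (1 + um * z)) := by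
        rw [integral_div]
        exact div_le_div_of_nonneg_right hMbd hcz.le
end
end

section
/- For every real b ∈ (0,1), log((1+b)(1+√b)²)/log(1/b) > 2b/(1−b). -/
open MeasureTheory Set Real Filter

noncomputable section

/-- The derivative of the auxiliary function of `rational_lt_log_add_log`, in factored form. -/
lemma hasDerivAt_log_add_log_sub_rational {y : ℝ} (hy : 0 ≤ y) :
    HasDerivAt
      (fun x : ℝ => log (1 + x ^ 2) + 2 * log (1 + x)
        - (x ^ 2 * (1 - x ^ 2) / (1 + x ^ 2) + x + x ^ 2))
      ((1 - y) * (1 - 2 * y - 2 * y ^ 2 - 2 * y ^ 3 + y ^ 4) / ((1 + y ^ 2) ^ 2 * (1 + y))) y := by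
  have h1 : 1 + y ^ 2 ≠ 0 := by positivity
  have h2 : 1 + y ≠ 0 := by positivity
  have hid := hasDerivAt_id' y
  have hsq := hid.pow 2
  have hd := (((hsq.const_add 1).log h1).add (((hid.const_add 1).log h2).const_mul 2)).sub
    ((((hsq.mul (hsq.const_sub 1)).div (hsq.const_add 1) h1).add hid).add hsq)
  refine hd.congr_deriv ?_
  simp only [Pi.pow_apply, Pi.mul_apply]
  field_simp
  ring

lemma rational_lt_log_add_log {x : ℝ} (h0 : 0 < x) (h1 : x < 1) :
    x ^ 2 * (1 - x ^ 2) / (1 + x ^ 2) + x + x ^ 2 < log (1 + x ^ 2) + 2 * log (1 + x) := by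
  set K : ℝ → ℝ := fun x => log (1 + x ^ 2) + 2 * log (1 + x)
    - (x ^ 2 * (1 - x ^ 2) / (1 + x ^ 2) + x + x ^ 2) with hK
  have hd : ∀ y : ℝ, 0 ≤ y → HasDerivAt K _ y :=
    fun y hy => hasDerivAt_log_add_log_sub_rational hy
  have hanti : ∀ y z : ℝ, 0 ≤ y → y < z → z ≤ 1 →
      1 - 2 * z - 2 * z ^ 2 - 2 * z ^ 3 + z ^ 4 < 1 - 2 * y - 2 * y ^ 2 - 2 * y ^ 3 + y ^ 4 := by
    intro y z hy hyz hz
    have h2 : y ^ 2 ≤ z ^ 2 := by gcongr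
    have h3 : y ^ 3 ≤ z ^ 3 := by gcongr
    have hz2 : z ^ 2 ≤ 1 := pow_le_one₀ (by linarith) hz
    have hy2 : y ^ 2 ≤ 1 := h2.trans hz2
    have h4 : z ^ 4 - y ^ 4 ≤ 2 * (z ^ 2 - y ^ 2) := by
      nlinarith [mul_nonneg (sub_nonneg.2 h2) (by linarith : 0 ≤ 2 - z ^ 2 - y ^ 2)]
    linarith
  suffices 0 < K x by simp only [hK] at this; linarith
  rcases le_total 0 (1 - 2 * x - 2 * x ^ 2 - 2 * x ^ 3 + x ^ 4) with hq | hq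
  · have hmono : StrictMonoOn K (Icc 0 x) := by
      refine strictMonoOn_of_deriv_pos (convex_Icc _ _)
        (fun y hy => (hd y hy.1).continuousAt.continuousWithinAt) fun y hy => ?_
      rw [interior_Icc] at hy
      rw [(hd y hy.1.le).deriv]
      have := hanti y x hy.1.le hy.2 h1.le
      have := hy.1
      exact div_pos (mul_pos (by linarith [hy.2]) (by linarith)) (by positivity)
    have := hmono (left_mem_Icc.2 h0.le) (right_mem_Icc.2 h0.le) h0
    simpa [hK] using this
  · have hmono : AntitoneOn K (Icc x 1) := by
      refine antitoneOn_of_deriv_nonpos (convex_Icc _ _)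
        (fun y hy => (hd y (h0.le.trans hy.1)).continuousAt.continuousWithinAt)
        (fun y hy => ?_) fun y hy => ?_
      all_goals rw [interior_Icc] at hy
      · exact (hd y (h0.le.trans hy.1.le)).differentiableAt.differentiableWithinAt
      · have hy0 := h0.trans hy.1
        rw [(hd y hy0.le).deriv]
        have := hanti x y h0.le hy.1 hy.2.le
        exact div_nonpos_of_nonpos_of_nonneg
          (mul_nonpos_of_nonneg_of_nonpos (by linarith [hy.2]) (by linarith)) (by positivity)
    have := hmono (left_mem_Icc.2 h1.le) (right_mem_Icc.2 h1.le) h1.le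
    have hK1 : K 1 = 3 * log 2 - 2 := by
      simp only [hK]
      norm_num
      ring
    linarith [log_two_gt_d9]

lemma neg_four_mul_log_lt {x : ℝ} (h0 : 0 < x) (h1 : x < 1) :
    -(4 * log x) < ((x ^ 2)⁻¹ - 1) * (log (1 + x ^ 2) + 2 * log (1 + x)) := by
  set H : ℝ → ℝ := fun x =>
    ((x ^ 2)⁻¹ - 1) * (log (1 + x ^ 2) + 2 * log (1 + x)) + 4 * log x with hH
  have hd : ∀ y : ℝ, 0 < y → HasDerivAt H (-(2 / y ^ 3) * (log (1 + y ^ 2) + 2 * log (1 + y)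
      - (y ^ 2 * (1 - y ^ 2) / (1 + y ^ 2) + y + y ^ 2))) y := by
    intro y hy
    have h1 : 1 + y ^ 2 ≠ 0 := by positivity
    have h2 : 1 + y ≠ 0 := by positivity
    have h3 : y ^ 2 ≠ 0 := by positivity
    have hid := hasDerivAt_id' y
    have hsq := hid.pow 2
    have hd := (((hsq.inv h3).sub_const 1).mul
      (((hsq.const_add 1).log h1).add (((hid.const_add 1).log h2).const_mul 2))).add
      ((hasDerivAt_log hy.ne').const_mul 4)
    refine hd.congr_deriv ?_
    simp only [Pi.pow_apply, Pi.add_apply, Pi.inv_apply]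
    field_simp
    ring
  have hanti : StrictAntiOn H (Icc x 1) := by
    refine strictAntiOn_of_deriv_neg (convex_Icc _ _)
      (fun y hy => (hd y (h0.trans_le hy.1)).continuousAt.continuousWithinAt) fun y hy => ?_
    rw [interior_Icc] at hy
    have hy0 := h0.trans hy.1
    rw [(hd y hy0).deriv]
    have : 0 < 2 / y ^ 3 := by positivity
    exact mul_neg_of_neg_of_pos (by linarith)
      (by linarith [rational_lt_log_add_log hy0 hy.2])
  have := hanti (left_mem_Icc.2 h1.le) (right_mem_Icc.2 h1.le) h1
  simp only [hH] at this
  norm_num at this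
  linarith

/-- Inequality (4.23.2.1): `log((1+b)(1+√b)²)/log(1/b) > 2b/(1-b)` for `b ∈ (0,1)`. -/
theorem log_ineq (b : ℝ) (hb : b ∈ Set.Ioo (0:ℝ) 1) :
    2 * b / (1 - b) < Real.log ((1 + b) * (1 + Real.sqrt b) ^ 2) / Real.log (1 / b) := by
  obtain ⟨hb0, hb1⟩ := hb
  have hs0 : 0 < √b := sqrt_pos.2 hb0
  have hs1 : √b < 1 := (sqrt_lt' one_pos).2 (by simpa using hb1)
  have key := neg_four_mul_log_lt hs0 hs1
  rw [sq_sqrt hb0.le, log_sqrt hb0.le] at key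
  have hlog : log b < 0 := log_neg hb0 hb1
  rw [log_mul (by positivity) (by positivity), log_pow, one_div, log_inv,
    div_lt_div_iff₀ (by linarith) (by linarith)]
  have hmul := mul_lt_mul_of_pos_left key hb0
  have hcancel : b * ((b⁻¹ - 1) * (log (1 + b) + 2 * log (1 + √b))) =
      (1 - b) * (log (1 + b) + 2 * log (1 + √b)) := by
    field_simp
  rw [hcancel] at hmul
  push_cast
  linarith
end
end

section
/- The function f₂(x) = x·log(1/x)/(1 − x²) is strictly increasing on the interval (0,1), and satisfies f₂(x) < 1/2 for all x ∈ (0,1); moreover f₂(x) tends to 1/2 as x tends to 1 from below. -/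
open MeasureTheory Set Real Filter

noncomputable section

lemma strictConvexOn_sinh_Ici : StrictConvexOn ℝ (Set.Ici 0) Real.sinh := by
  refine strictConvexOn_of_deriv2_pos (convex_Ici 0) Real.continuous_sinh.continuousOn ?_
  intro x hx
  rw [interior_Ici, Set.mem_Ioi] at hx
  simpa using hx

lemma div_sinh_lt_div_sinh {s t : ℝ} (hs : 0 < s) (hst : s < t) :
    t / Real.sinh t < s / Real.sinh s := by
  have h := strictConvexOn_sinh_Ici.secant_strict_mono (a := 0) (x := s) (y := t)
    Set.self_mem_Ici hs.le (hs.trans hst).le hs.ne' (hs.trans hst).ne' hst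
  have hs' : 0 < Real.sinh s := Real.sinh_pos_iff.2 hs
  have ht' : 0 < Real.sinh t := Real.sinh_pos_iff.2 (hs.trans hst)
  simp only [Real.sinh_zero, sub_zero] at h
  rw [div_lt_div_iff₀ hs (hs.trans hst)] at h
  rw [div_lt_div_iff₀ ht' hs']
  linarith

lemma mul_log_one_div_div_eq {x : ℝ} (hx : x ∈ Set.Ioo (0 : ℝ) 1) :
    x * Real.log (1 / x) / (1 - x ^ 2) = -Real.log x / Real.sinh (-Real.log x) / 2 := by
  have h0 : x ≠ 0 := hx.1.ne'
  have h1 : 1 - x ^ 2 ≠ 0 := by nlinarith [hx.1, hx.2]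
  have h2 : Real.sinh (-Real.log x) = (1 - x ^ 2) / (2 * x) := by
    rw [Real.sinh_neg, Real.sinh_log hx.1]
    field_simp
    ring
  rw [h2, one_div, Real.log_inv]
  field_simp

/-- The function `f₂(x) = x log(1/x)/(1-x²)` is strictly increasing on `(0,1)`,
bounded above by `1/2` there, and tends to `1/2` as `x → 1⁻`. -/
theorem f2_properties :
    StrictMonoOn (fun x : ℝ => x * Real.log (1/x) / (1 - x ^ 2)) (Set.Ioo 0 1) ∧
    (∀ x ∈ Set.Ioo (0:ℝ) 1, x * Real.log (1/x) / (1 - x ^ 2) < 1/2) ∧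
    Filter.Tendsto (fun x : ℝ => x * Real.log (1/x) / (1 - x ^ 2))
      (nhdsWithin 1 (Set.Iio 1)) (nhds (1/2)) := by
  refine ⟨?_, ?_, ?_⟩
  · intro x hx y hy hxy
    simp only [mul_log_one_div_div_eq hx, mul_log_one_div_div_eq hy]
    have := div_sinh_lt_div_sinh (neg_pos.2 (Real.log_neg hy.1 hy.2))
      (neg_lt_neg (Real.log_lt_log hx.1 hxy))
    linarith
  · intro x hx
    rw [mul_log_one_div_div_eq hx]
    have ht : 0 < -Real.log x := neg_pos.2 (Real.log_neg hx.1 hx.2)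
    have := (div_lt_one (Real.sinh_pos_iff.2 ht)).2 (Real.self_lt_sinh_iff.2 ht)
    linarith
  · have hlog : Tendsto (slope Real.log 1) (nhdsWithin 1 (Set.Iio 1)) (nhds 1) := by
      simpa using (hasDerivAt_iff_tendsto_slope_left_right.1
        (Real.hasDerivAt_log one_ne_zero)).1
    have hfrac : Tendsto (fun x : ℝ => x / (1 + x)) (nhdsWithin 1 (Set.Iio 1))
        (nhds (1 / (1 + 1))) := by
      have : ContinuousAt (fun x : ℝ => x / (1 + x)) 1 :=
        continuousAt_id.div (by fun_prop) (by norm_num)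
      exact this.tendsto.mono_left nhdsWithin_le_nhds
    have h := hfrac.mul hlog
    norm_num only at h ⊢
    refine h.congr' ?_
    filter_upwards [Ioo_mem_nhdsLT (zero_lt_one' ℝ)] with x hx
    have h1 : x - 1 ≠ 0 := sub_ne_zero.2 hx.2.ne
    have h2 : 1 + x ≠ 0 := by linarith [hx.1]
    have h3 : 1 - x ^ 2 = -((1 + x) * (x - 1)) := by ring
    rw [slope_def_field, Real.log_one, h3, one_div, Real.log_inv]
    field_simp
    ring
end
end

section
/- The function b ↦ 1 + log((1+b)(1+√b)²)/log(1/b) is strictly increasing on the interval (0,1), tends to 1 as b tends to 0 from above, and tends to +∞ as b tends to 1 from below. -/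
open MeasureTheory Set Real Filter

noncomputable section

theorem log_one_add_mul_sq_strictMonoOn :
    StrictMonoOn (fun b : ℝ => Real.log ((1 + b) * (1 + Real.sqrt b) ^ 2)) (Set.Ici 0) := by
  intro x hx y _ hxy
  have hx0 : 0 ≤ x := hx
  have hsqrt : Real.sqrt x < Real.sqrt y := Real.sqrt_lt_sqrt hx0 hxy
  have hsx := Real.sqrt_nonneg x
  apply Real.log_lt_log (by positivity)
  gcongr

theorem continuous_one_add_mul_sq :
    Continuous (fun b : ℝ => (1 + b) * (1 + Real.sqrt b) ^ 2) := by
  fun_prop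

/-- The function `b ↦ 1 + log((1+b)(1+√b)²)/log(1/b)` is strictly increasing on
`(0,1)`, tends to `1` at `0⁺` and to `+∞` at `1⁻`. -/
theorem b1_inverse_properties :
    StrictMonoOn
      (fun b : ℝ => 1 + Real.log ((1 + b) * (1 + Real.sqrt b) ^ 2) / Real.log (1 / b))
      (Set.Ioo 0 1) ∧
    Filter.Tendsto
      (fun b : ℝ => 1 + Real.log ((1 + b) * (1 + Real.sqrt b) ^ 2) / Real.log (1 / b))
      (nhdsWithin 0 (Set.Ioi 0)) (nhds 1) ∧
    Filter.Tendsto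
      (fun b : ℝ => 1 + Real.log ((1 + b) * (1 + Real.sqrt b) ^ 2) / Real.log (1 / b))
      (nhdsWithin 1 (Set.Iio 1)) Filter.atTop := by
  refine ⟨?_, ?_, ?_⟩
  · intro x hx y hy hxy
    have hnum := log_one_add_mul_sq_strictMonoOn hx.1.le hy.1.le hxy
    have hpos := log_one_add_mul_sq_strictMonoOn Set.self_mem_Ici hy.1.le hy.1
    have hden : Real.log (1 / y) ≤ Real.log (1 / x) :=
      Real.log_le_log (one_div_pos.2 hy.1) (one_div_le_one_div_of_le hx.1 hxy.le)
    have hden_pos : 0 < Real.log (1 / y) := Real.log_pos (one_lt_one_div hy.1 hy.2)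
    simp only [add_zero, Real.sqrt_zero, one_pow, mul_one, Real.log_one] at hpos hnum
    have := div_lt_div₀ hnum hden hpos.le hden_pos
    simpa using this
  · have hnum : Tendsto (fun b : ℝ => Real.log ((1 + b) * (1 + Real.sqrt b) ^ 2))
        (nhdsWithin 0 (Set.Ioi 0)) (nhds 0) := by
      have h := (continuous_one_add_mul_sq.continuousAt (x := 0)).log (by simp)
      simpa using h.tendsto.mono_left nhdsWithin_le_nhds
    have hden : Tendsto (fun b : ℝ => Real.log (1 / b)) (nhdsWithin 0 (Set.Ioi 0)) atTop := by
      simpa only [one_div, Function.comp_def] using Real.tendsto_log_atTop.comp tendsto_inv_nhdsGT_zero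
    simpa using (hnum.div_atTop hden).const_add 1
  · have hnum : Tendsto (fun b : ℝ => Real.log ((1 + b) * (1 + Real.sqrt b) ^ 2))
        (nhdsWithin 1 (Set.Iio 1)) (nhds (Real.log ((1 + 1) * (1 + Real.sqrt 1) ^ 2))) :=
      ((continuous_one_add_mul_sq.continuousAt (x := 1)).log
        (by positivity)).tendsto.mono_left nhdsWithin_le_nhds
    have hden : Tendsto (fun b : ℝ => Real.log (1 / b)) (nhdsWithin 1 (Set.Iio 1))
        (nhdsWithin 0 (Set.Ioi 0)) := by
      refine tendsto_nhdsWithin_iff.2 ⟨?_, ?_⟩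
      · have h : ContinuousAt (fun b : ℝ => Real.log (1 / b)) 1 :=
          (continuousAt_const.div continuousAt_id one_ne_zero).log (by simp)
        simpa using h.tendsto.mono_left nhdsWithin_le_nhds
      · filter_upwards [Ioo_mem_nhdsLT (zero_lt_one' ℝ)] with b hb
        exact Real.log_pos (one_lt_one_div hb.1 hb.2)
    have hlim_pos : 0 < Real.log ((1 + 1) * (1 + Real.sqrt 1) ^ 2) :=
      Real.log_pos (by norm_num)
    exact tendsto_atTop_add_const_left _ 1
      (hnum.pos_mul_atTop hlim_pos (tendsto_inv_nhdsGT_zero.comp hden))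
end
end

section
/- The function g(x) = x − log(1/x)/(2(1 − x²)) is strictly increasing on the interval (0,1) and has a unique zero μ in (0,1); moreover μ < 0.479. -/
open MeasureTheory Set Real Filter

noncomputable section

/-- The secant slope of the logarithm based at `1`, evaluated at squares, is strictly decreasing. -/
theorem strictAntiOn_log_inv_div_one_sub_sq :
    StrictAntiOn (fun x : ℝ => Real.log (1/x) / (2 * (1 - x ^ 2))) (Set.Ioo 0 1) := by
  have key : ∀ x ∈ Set.Ioo (0:ℝ) 1, Real.log (1/x) / (2 * (1 - x ^ 2)) =
      (Real.log (x ^ 2) - Real.log 1) / (x ^ 2 - 1) / 4 := by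
    rintro x ⟨hx0, hx1⟩
    have h : 1 - x ^ 2 ≠ 0 := by nlinarith
    have h' : x ^ 2 - 1 ≠ 0 := by nlinarith
    rw [one_div, Real.log_inv, Real.log_pow, Real.log_one]
    field_simp
    push_cast
    ring
  intro x hx y hy hxy
  simp only [key x hx, key y hy]
  have hx2 : x ^ 2 < 1 := by nlinarith [hx.1, hx.2]
  have hy2 : y ^ 2 < 1 := by nlinarith [hy.1, hy.2]
  have hxy2 : x ^ 2 < y ^ 2 := by nlinarith [hx.1, hy.1]
  have := strictConcaveOn_log_Ioi.secant_strict_mono (a := 1) (x := x ^ 2) (y := y ^ 2)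
    (Set.mem_Ioi.2 one_pos) (Set.mem_Ioi.2 (pow_pos hx.1 2)) (Set.mem_Ioi.2 (pow_pos hy.1 2))
    hx2.ne hy2.ne hxy2
  linarith

/-- The function `x ↦ x - log(1/x)/(2(1-x²))` is strictly increasing on `(0,1)`
and has a unique zero `μ ∈ (0,1)`, with `μ < 0.479`. -/
theorem mu_properties :
    StrictMonoOn (fun x : ℝ => x - Real.log (1/x) / (2 * (1 - x ^ 2))) (Set.Ioo 0 1) ∧
    ∃ μ ∈ Set.Ioo (0:ℝ) 1,
      μ - Real.log (1/μ) / (2 * (1 - μ ^ 2)) = 0 ∧ μ < 0.479 ∧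
      ∀ μ' ∈ Set.Ioo (0:ℝ) 1, μ' - Real.log (1/μ') / (2 * (1 - μ' ^ 2)) = 0 → μ' = μ := by
  have hmono : StrictMonoOn (fun x : ℝ => x - Real.log (1/x) / (2 * (1 - x ^ 2)))
      (Set.Ioo 0 1) := by
    intro x hx y hy hxy
    have := strictAntiOn_log_inv_div_one_sub_sq hx hy hxy
    simp only at this ⊢
    linarith
  refine ⟨hmono, ?_⟩
  have hcont : ContinuousOn (fun x : ℝ => x - Real.log (1/x) / (2 * (1 - x ^ 2)))
      (Set.Icc (1/4) 0.479) := by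
    intro x hx
    have hx0 : 0 < x := by linarith [hx.1]
    have hx1 : x < 1 := by have := hx.2; norm_num at this; linarith
    have h : 2 * (1 - x ^ 2) ≠ 0 := by nlinarith
    have h' : 1 / x ≠ 0 := by positivity
    have hx' : x ≠ 0 := hx0.ne'
    exact ContinuousAt.continuousWithinAt (by fun_prop (disch := assumption))
  have hleft : (1/4 : ℝ) - Real.log (1/(1/4)) / (2 * (1 - (1/4) ^ 2)) < 0 := by
    have h : Real.log (1/(1/4)) = 2 * Real.log 2 := by
      rw [show (1/(1/4) : ℝ) = 2 ^ 2 by norm_num, Real.log_pow]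
      norm_num
    rw [h, sub_neg, lt_div_iff₀ (by norm_num)]
    linarith [Real.log_two_gt_d9]
  have hright : 0 < (0.479 : ℝ) - Real.log (1/0.479) / (2 * (1 - 0.479 ^ 2)) := by
    have h : Real.log (1/0.479) = Real.log 2 + Real.log (1/0.958) := by
      rw [← Real.log_mul (by norm_num) (by norm_num)]
      norm_num
    have h' : Real.log (1/0.958) ≤ 1/0.958 - 1 := Real.log_le_sub_one_of_pos (by norm_num)
    rw [h, sub_pos, div_lt_iff₀ (by norm_num)]
    norm_num at h' ⊢
    linarith [Real.log_two_lt_d9]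
  obtain ⟨μ, ⟨hμl, hμr⟩, hμ⟩ :=
    intermediate_value_Ioo (by norm_num) hcont (show (0:ℝ) ∈ Set.Ioo _ _ from ⟨hleft, hright⟩)
  have hmem : μ ∈ Set.Ioo (0:ℝ) 1 := ⟨by linarith, by norm_num at hμr; linarith⟩
  exact ⟨μ, hmem, hμ, hμr, fun ν hν h => hmono.injOn hν hmem (h.trans hμ.symm)⟩
end
end

section
/- Let ζ, y, a′, m be strictly positive real numbers such that ζ(1 + a′ζ²) ≤ y ≤ m. Then ζ ≤ y(1 − a y²), where a = a′/(1 + 3a′m²). -/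
open MeasureTheory Set Real Filter

noncomputable section

/-- Remark 8.1: if `0 < ζ(1+a'ζ²) ≤ y ≤ m` then `ζ ≤ y(1-ay²)` with
`a = a'/(1+3a'm²)`. -/
theorem inverse_inequality (ζ y a' m : ℝ)
    (hζ : 0 < ζ) (ha' : 0 < a') (hm : 0 < m)
    (h1 : ζ * (1 + a' * ζ ^ 2) ≤ y) (h2 : y ≤ m) :
    ζ ≤ y * (1 - (a' / (1 + 3 * a' * m ^ 2)) * y ^ 2) := by
  have hy : 0 < y := lt_of_lt_of_le (by positivity) h1
  set a := a' / (1 + 3 * a' * m ^ 2) with ha_def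
  have ha : 0 < a := by positivity
  have ha_eq : a' * (1 - 3 * (a * m ^ 2)) = a := by
    rw [ha_def]
    field_simp
    ring
  have ht0 : 0 < a * y ^ 2 := by positivity
  have htm : a * y ^ 2 ≤ a * m ^ 2 := by gcongr
  have ht1 : 0 < 1 - 3 * (a * m ^ 2) := 
    pos_of_mul_pos_right (ha.trans_eq ha_eq.symm) ha'.le
  have hu : 0 < 1 - a * y ^ 2 := by linarith
  have hcube : 1 - 3 * (a * y ^ 2) ≤ (1 - a * y ^ 2) ^ 3 := by
    nlinarith [mul_nonneg (sq_nonneg (a * y ^ 2)) (by linarith : 0 ≤ 3 - a * y ^ 2)]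
  have hau : a ≤ a' * (1 - a * y ^ 2) ^ 3 := by
    calc a = a' * (1 - 3 * (a * m ^ 2)) := ha_eq.symm
      _ ≤ a' * (1 - a * y ^ 2) ^ 3 := by
        gcongr
        linarith
  set w := y * (1 - a * y ^ 2) with hw_def
  have hw : 0 < w := by positivity
  have hfw : y ≤ w * (1 + a' * w ^ 2) := by
    have h := mul_le_mul_of_nonneg_left hau (by positivity : 0 ≤ y ^ 3)
    rw [hw_def]
    linarith
  by_contra! hlt
  have hmono : w * (1 + a' * w ^ 2) < ζ * (1 + a' * ζ ^ 2) := by gcongr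
  linarith
end
end

section
/- For every λ ∈ (0,1), setting a(λ) = min{2λ/(1−λ), (1+λ)/2}, one has (1−λ²)(a(λ)+λ) / ((1+λ)(1 − a(λ)λ²)) ≤ (1+3λ)/(2+2λ+λ²) ≤ 9/(4+2√13), and 9/(4+2√13) < 0.803. -/
open MeasureTheory Set Real Filter

noncomputable section

/-- Inequality (6.21): for `λ ∈ (0,1)` and `a(λ) = min(2λ/(1-λ), (1+λ)/2)`,
`(1-λ²)(a(λ)+λ)/((1+λ)(1-a(λ)λ²)) ≤ (1+3λ)/(2+2λ+λ²) ≤ 9/(4+2√13) < 0.803`. -/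
theorem phi_prime_bound (lam : ℝ) (hlam : lam ∈ Set.Ioo (0:ℝ) 1) :
    (1 - lam ^ 2) * (min (2 * lam / (1 - lam)) ((1 + lam) / 2) + lam) /
        ((1 + lam) * (1 - min (2 * lam / (1 - lam)) ((1 + lam) / 2) * lam ^ 2)) ≤
      (1 + 3 * lam) / (2 + 2 * lam + lam ^ 2) ∧
    (1 + 3 * lam) / (2 + 2 * lam + lam ^ 2) ≤ 9 / (4 + 2 * Real.sqrt 13) ∧
    9 / (4 + 2 * Real.sqrt 13) < 0.803 := by
  obtain ⟨h0, h1⟩ := hlam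
  have hs : Real.sqrt 13 ^ 2 = 13 := Real.sq_sqrt (by norm_num)
  have hs' : 3.605 < Real.sqrt 13 := Real.lt_sqrt_of_sq_lt (by norm_num)
  refine ⟨?_, ?_, ?_⟩
  · have hm : min (2 * lam / (1 - lam)) ((1 + lam) / 2) ≤ (1 + lam) / 2 := min_le_right _ _
    generalize min (2 * lam / (1 - lam)) ((1 + lam) / 2) = m at hm ⊢
    have hden : 0 < 1 - m * lam ^ 2 := by
      nlinarith [mul_le_mul_of_nonneg_right hm (sq_nonneg lam)]
    have hlam_pos : 0 < 1 + lam := by linarith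
    rw [div_le_div_iff₀ (by positivity) (by positivity)]
    have key : (1 + 3 * lam) * ((1 + lam) * (1 - m * lam ^ 2)) -
        (1 - lam ^ 2) * (m + lam) * (2 + 2 * lam + lam ^ 2) =
        2 * ((1 + lam) / 2 - m) * ((1 + lam) * (1 + lam ^ 3)) := by ring
    have hgap : 0 ≤ (1 + lam) / 2 - m := sub_nonneg.2 hm
    exact sub_nonneg.1 (key ▸ by positivity)
  · rw [div_le_div_iff₀ (by positivity) (by positivity)]
    nlinarith [sq_nonneg (3 * lam + 1 - Real.sqrt 13)]
  · rw [div_lt_iff₀ (by positivity)]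
    linarith
end
end
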